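/- arXiv:math/0303137 — 2 statements merged into one kernel-verified Lean document; each statement's English description precedes it below -/
import Mathlib

section
/- Let n > 2 and α ∈ (0, n/2 − 1). For every continuous f : ℝⁿ → ℝ with |f(x)| ≤ C(1+|x|²)^(−α−1), there exists exactly one strong solution u : ℝⁿ → ℝ of −Δu = f on ℝⁿ satisfying |u(x)| ≤ C'(1+|x|²)^(−α) for some constant C'. -/
open Real MeasureTheory

/-- The Euclidean Laplacian of a function on `ℝⁿ`. -/
noncomputable def laplacian {n : ℕ} (f : EuclideanSpace ℝ (Fin n) → ℝ)
    (x : EuclideanSpace ℝ (Fin n)) : ℝ :=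
  ∑ i, fderiv ℝ (fun y => fderiv ℝ f y (EuclideanSpace.single i 1)) x
    (EuclideanSpace.single i 1)

section NewtonPotential

open Filter Topology

variable {n : ℕ}

/-- The `i`-th partial derivative of a function on `ℝⁿ`. -/
noncomputable def coordDeriv (i : Fin n) (W : EuclideanSpace ℝ (Fin n) → ℝ)
    (x : EuclideanSpace ℝ (Fin n)) : ℝ :=
  fderiv ℝ W x (EuclideanSpace.single i 1)

theorem laplacian_eq_sum_coordDeriv (W : EuclideanSpace ℝ (Fin n) → ℝ)
    (x : EuclideanSpace ℝ (Fin n)) :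
    laplacian W x = ∑ i, coordDeriv i (coordDeriv i W) x := rfl

/-- The bound `|g z| ≤ D (1 + ‖z‖²)^(-β)` for some constant `D`. -/
def PowDecay (β : ℝ) (g : EuclideanSpace ℝ (Fin n) → ℝ) : Prop :=
  ∃ D, ∀ z, |g z| ≤ D * (1 + ‖z‖ ^ 2) ^ (-β)

namespace PowDecay

variable {β γ : ℝ} {g h : EuclideanSpace ℝ (Fin n) → ℝ}

theorem mul (hg : PowDecay β g) (hh : PowDecay γ h) : PowDecay (β + γ) (fun z => g z * h z) := by
  obtain ⟨D, hD⟩ := hg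
  obtain ⟨D', hD'⟩ := hh
  refine ⟨D * D', fun z => ?_⟩
  have hp : 0 < 1 + ‖z‖ ^ 2 := by positivity
  rw [abs_mul, neg_add, rpow_add hp]
  calc |g z| * |h z| ≤ (D * (1 + ‖z‖ ^ 2) ^ (-β)) * (D' * (1 + ‖z‖ ^ 2) ^ (-γ)) :=
        mul_le_mul (hD z) (hD' z) (abs_nonneg _) ((abs_nonneg _).trans (hD z))
    _ = _ := by ring

theorem add (hg : PowDecay β g) (hh : PowDecay β h) : PowDecay β (fun z => g z + h z) := by
  obtain ⟨D, hD⟩ := hg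
  obtain ⟨D', hD'⟩ := hh
  refine ⟨D + D', fun z => (abs_add_le _ _).trans ?_⟩
  rw [add_mul]
  exact add_le_add (hD z) (hD' z)

theorem const_mul (hg : PowDecay β g) (c : ℝ) : PowDecay β (fun z => c * g z) := by
  obtain ⟨D, hD⟩ := hg
  refine ⟨|c| * D, fun z => ?_⟩
  rw [abs_mul, mul_assoc]
  exact mul_le_mul_of_nonneg_left (hD z) (abs_nonneg c)

theorem neg (hg : PowDecay β g) : PowDecay β (fun z => -g z) := by
  simpa [PowDecay] using hg

theorem sub (hg : PowDecay β g) (hh : PowDecay β h) : PowDecay β (fun z => g z - h z) := by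
  simpa [sub_eq_add_neg] using hg.add hh.neg

theorem finset_sum {ι : Type*} (s : Finset ι) {G : ι → EuclideanSpace ℝ (Fin n) → ℝ}
    (hG : ∀ i, PowDecay β (G i)) : PowDecay β (fun z => ∑ i ∈ s, G i z) := by
  classical
  induction s using Finset.induction_on with
  | empty => exact ⟨0, by simp⟩
  | insert a s ha ih => simpa [Finset.sum_insert ha] using (hG a).add ih

theorem of_abs_le (hh : PowDecay β h) (hgh : ∀ z, |g z| ≤ |h z|) : PowDecay β g := by
  obtain ⟨D, hD⟩ := hh
  exact ⟨D, fun z => (hgh z).trans (hD z)⟩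

theorem mono (hg : PowDecay β g) (hγ : γ ≤ β) : PowDecay γ g := by
  obtain ⟨D, hD⟩ := hg
  refine ⟨|D|, fun z => (hD z).trans ?_⟩
  have h1 : (1 + ‖z‖ ^ 2) ^ (-β) ≤ (1 + ‖z‖ ^ 2) ^ (-γ) :=
    rpow_le_rpow_of_exponent_le (by nlinarith [sq_nonneg ‖z‖]) (by linarith)
  exact mul_le_mul (le_abs_self D) h1 (by positivity) (abs_nonneg D)

theorem integrable (hg : PowDecay β g) (hm : AEStronglyMeasurable g volume)
    (hβ : (n : ℝ) < 2 * β) : Integrable g := by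
  obtain ⟨D, hD⟩ := hg
  have h1 : Integrable (fun z : EuclideanSpace ℝ (Fin n) => (1 + ‖z‖ ^ 2) ^ (-(2 * β) / 2)) :=
    integrable_rpow_neg_one_add_norm_sq (by simpa using hβ)
  refine (h1.const_mul D).mono' hm (ae_of_all _ fun z => ?_)
  rw [Real.norm_eq_abs, neg_div, mul_div_cancel_left₀ _ two_ne_zero]
  exact hD z

/-- Peetre's inequality. -/
theorem one_add_norm_sq_le (x z : EuclideanSpace ℝ (Fin n)) :
    1 + ‖z‖ ^ 2 ≤ 2 * (1 + ‖x‖ ^ 2) * (1 + ‖x + z‖ ^ 2) := by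
  have h1 : ‖z‖ ≤ ‖x + z‖ + ‖x‖ := by
    simpa using norm_sub_le (x + z) x
  have h2 : ‖z‖ ^ 2 ≤ (‖x + z‖ + ‖x‖) ^ 2 := by gcongr
  nlinarith [sq_nonneg (‖x + z‖ - ‖x‖), mul_nonneg (sq_nonneg ‖x + z‖) (sq_nonneg ‖x‖)]

theorem rpow_add_left_le (hβ : 0 ≤ β) (x z : EuclideanSpace ℝ (Fin n)) :
    (1 + ‖x + z‖ ^ 2) ^ (-β) ≤ (2 * (1 + ‖x‖ ^ 2)) ^ β * (1 + ‖z‖ ^ 2) ^ (-β) := by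
  have h := rpow_le_rpow (by positivity) (one_add_norm_sq_le x z) hβ
  rw [mul_rpow (by positivity) (by positivity)] at h
  rw [rpow_neg (by positivity), rpow_neg (by positivity), ← div_eq_mul_inv, ← one_div,
    div_le_div_iff₀ (by positivity) (by positivity), one_mul]
  exact h

theorem comp_add_left (hg : PowDecay β g) (hβ : 0 ≤ β) (x : EuclideanSpace ℝ (Fin n)) :
    PowDecay β (fun z => g (x + z)) := by
  obtain ⟨D, hD⟩ := hg
  refine ⟨|D| * (2 * (1 + ‖x‖ ^ 2)) ^ β, fun z => (hD _).trans ?_⟩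
  rw [mul_assoc]
  exact mul_le_mul (le_abs_self D) (rpow_add_left_le hβ x z) (by positivity) (abs_nonneg D)

theorem of_hasCompactSupport (hc : Continuous g) (hs : HasCompactSupport g) (β : ℝ) :
    PowDecay β g := by
  have hcont : Continuous fun z => g z * (1 + ‖z‖ ^ 2) ^ β :=
    hc.mul (Continuous.rpow_const (by fun_prop) fun z => Or.inl (by positivity))
  obtain ⟨D, hD⟩ := (hs.mul_right (f' := fun z => (1 + ‖z‖ ^ 2) ^ β)).exists_bound_of_continuous
    hcont
  refine ⟨D, fun z => ?_⟩
  have hp : 0 < (1 + ‖z‖ ^ 2) ^ β := by positivity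
  have h := hD z
  simp only [Pi.mul_apply] at h
  rw [Real.norm_eq_abs, abs_mul, abs_of_pos hp] at h
  rw [rpow_neg (by positivity), ← div_eq_mul_inv, le_div_iff₀ hp]
  exact h

theorem tendsto_cocompact (hg : PowDecay β g) (hβ : 0 < β) :
    Tendsto g (cocompact _) (𝓝 0) := by
  obtain ⟨D, hD⟩ := hg
  have h1 : Tendsto (fun z : EuclideanSpace ℝ (Fin n) => 1 + ‖z‖ ^ 2) (cocompact _) atTop :=
    tendsto_atTop_add_const_left _ _
      ((tendsto_pow_atTop two_ne_zero).comp
        (tendsto_norm_cocompact_atTop (E := EuclideanSpace ℝ (Fin n))))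
  have h2 := ((tendsto_rpow_neg_atTop hβ).comp h1).const_mul D
  rw [mul_zero] at h2
  exact squeeze_zero_norm hD h2

end PowDecay

/-- A `C²` function whose value, first derivatives and pure second derivatives are
`O((1 + ‖z‖²)^(-β))`. -/
structure DecaysC2 (β : ℝ) (W : EuclideanSpace ℝ (Fin n) → ℝ) : Prop where
  contDiff : ContDiff ℝ 2 W
  decay : PowDecay β W
  decay_coordDeriv : ∀ i, PowDecay β (coordDeriv i W)
  decay_coordDeriv₂ : ∀ i, PowDecay β (coordDeriv i (coordDeriv i W))

theorem ContDiff.coordDeriv {W : EuclideanSpace ℝ (Fin n) → ℝ} {k : WithTop ℕ∞}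
    (hW : ContDiff ℝ (k + 1) W) (i : Fin n) : ContDiff ℝ k (coordDeriv i W) :=
  (hW.fderiv_right le_rfl).clm_apply contDiff_const

theorem HasCompactSupport.coordDeriv {W : EuclideanSpace ℝ (Fin n) → ℝ}
    (hW : HasCompactSupport W) (i : Fin n) : HasCompactSupport (coordDeriv i W) :=
  hW.fderiv_apply ℝ _

theorem coordDeriv_comp_add_left (i : Fin n) (W : EuclideanSpace ℝ (Fin n) → ℝ)
    (x : EuclideanSpace ℝ (Fin n)) :
    coordDeriv i (fun z => W (x + z)) = fun z => coordDeriv i W (x + z) := by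
  ext z
  simp only [coordDeriv, fderiv_comp_add_left]

theorem laplacian_comp_add_left (W : EuclideanSpace ℝ (Fin n) → ℝ)
    (x z : EuclideanSpace ℝ (Fin n)) :
    laplacian (fun z => W (x + z)) z = laplacian W (x + z) := by
  simp only [laplacian_eq_sum_coordDeriv, coordDeriv_comp_add_left]

namespace DecaysC2

variable {β γ : ℝ} {W G : EuclideanSpace ℝ (Fin n) → ℝ}

theorem continuous (hW : DecaysC2 β W) : Continuous W := hW.contDiff.continuous

theorem contDiff_coordDeriv (hW : DecaysC2 β W) (i : Fin n) : ContDiff ℝ 1 (coordDeriv i W) :=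
  ContDiff.coordDeriv (k := 1) hW.contDiff i

theorem continuous_coordDeriv (hW : DecaysC2 β W) (i : Fin n) : Continuous (coordDeriv i W) :=
  (hW.contDiff_coordDeriv i).continuous

theorem continuous_coordDeriv₂ (hW : DecaysC2 β W) (i : Fin n) :
    Continuous (coordDeriv i (coordDeriv i W)) :=
  (ContDiff.coordDeriv (k := 0) (hW.contDiff_coordDeriv i) i).continuous

theorem continuous_laplacian (hW : DecaysC2 β W) : Continuous (laplacian W) :=
  continuous_finsetSum _ fun i _ => hW.continuous_coordDeriv₂ i

theorem comp_add_left (hW : DecaysC2 β W) (hβ : 0 ≤ β) (x : EuclideanSpace ℝ (Fin n)) :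
    DecaysC2 β (fun z => W (x + z)) where
  contDiff := hW.contDiff.comp (contDiff_const.add contDiff_id)
  decay := hW.decay.comp_add_left hβ x
  decay_coordDeriv i := by
    rw [coordDeriv_comp_add_left]
    exact (hW.decay_coordDeriv i).comp_add_left hβ x
  decay_coordDeriv₂ i := by
    rw [coordDeriv_comp_add_left, coordDeriv_comp_add_left]
    exact (hW.decay_coordDeriv₂ i).comp_add_left hβ x

theorem of_hasCompactSupport (hc : ContDiff ℝ 2 W) (hs : HasCompactSupport W) (β : ℝ) :
    DecaysC2 β W where
  contDiff := hc
  decay := .of_hasCompactSupport hc.continuous hs β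
  decay_coordDeriv i := .of_hasCompactSupport
    (ContDiff.coordDeriv (k := 1) hc i).continuous (hs.coordDeriv i) β
  decay_coordDeriv₂ i := .of_hasCompactSupport
    (ContDiff.coordDeriv (k := 0) (ContDiff.coordDeriv (k := 1) hc i) i).continuous
    ((hs.coordDeriv i).coordDeriv i) β

/-- Green's second identity on `ℝⁿ` for functions with sufficient joint decay. -/
theorem integral_mul_laplacian (hG : DecaysC2 β G) (hW : DecaysC2 γ W)
    (h : (n : ℝ) < 2 * (β + γ)) :
    ∫ z, G z * laplacian W z = ∫ z, laplacian G z * W z := by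
  have hGW := hG.continuous
  have hcW := hW.continuous
  have key : ∀ i, Integrable (fun z => G z * coordDeriv i (coordDeriv i W) z) ∧
      Integrable (fun z => coordDeriv i (coordDeriv i G) z * W z) ∧
      ∫ z, G z * coordDeriv i (coordDeriv i W) z =
        ∫ z, coordDeriv i (coordDeriv i G) z * W z := by
    intro i
    have c1 := hG.continuous_coordDeriv i
    have c2 := hG.continuous_coordDeriv₂ i
    have c3 := hW.continuous_coordDeriv i
    have c4 := hW.continuous_coordDeriv₂ i
    have i1 := (hG.decay.mul (hW.decay_coordDeriv₂ i)).integrable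
      (hGW.mul c4).aestronglyMeasurable h
    have i2 := ((hG.decay_coordDeriv i).mul (hW.decay_coordDeriv i)).integrable
      (c1.mul c3).aestronglyMeasurable h
    have i3 := (hG.decay.mul (hW.decay_coordDeriv i)).integrable
      (hGW.mul c3).aestronglyMeasurable h
    have i4 := ((hG.decay_coordDeriv i).mul hW.decay).integrable
      (c1.mul hcW).aestronglyMeasurable h
    have i5 := ((hG.decay_coordDeriv₂ i).mul hW.decay).integrable
      (c2.mul hcW).aestronglyMeasurable h
    refine ⟨i1, i5, ?_⟩
    have e1 := integral_mul_fderiv_eq_neg_fderiv_mul_of_integrable (f := G)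
      (g := coordDeriv i W) (v := EuclideanSpace.single i 1) (μ := volume) i2 i1 i3
      (fun z _ => hG.contDiff.differentiable two_ne_zero z)
      (fun z _ => (hW.contDiff_coordDeriv i).differentiable one_ne_zero z)
    have e2 := integral_mul_fderiv_eq_neg_fderiv_mul_of_integrable (f := coordDeriv i G)
      (g := W) (v := EuclideanSpace.single i 1) (μ := volume) i5 i2 i4
      (fun z _ => (hG.contDiff_coordDeriv i).differentiable one_ne_zero z)
      (fun z _ => hW.contDiff.differentiable two_ne_zero z)
    calc _ = _ := e1
      _ = _ := by
        rw [neg_eq_iff_eq_neg]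
        exact e2
  simp only [laplacian_eq_sum_coordDeriv, Finset.mul_sum, Finset.sum_mul]
  rw [integral_finsetSum _ fun i _ => (key i).1, integral_finsetSum _ fun i _ => (key i).2.1]
  exact Finset.sum_congr rfl fun i _ => (key i).2.2

end DecaysC2

/-- The radial profile `x ↦ (‖x‖² + a)^(-m)`. -/
noncomputable def radialPow (a m : ℝ) (x : EuclideanSpace ℝ (Fin n)) : ℝ :=
  (‖x‖ ^ 2 + a) ^ (-m)

section radialPow

variable {a b m : ℝ}

theorem radialPow_nonneg (ha : 0 ≤ a) (x : EuclideanSpace ℝ (Fin n)) : 0 ≤ radialPow a m x := by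
  unfold radialPow; positivity

theorem contDiff_radialPow (ha : 0 < a) (m : ℝ) {k : WithTop ℕ∞} :
    ContDiff ℝ k (radialPow (n := n) a m) :=
  ((contDiff_norm_sq ℝ).add contDiff_const).rpow_const_of_ne fun x => by positivity

theorem coordDeriv_radialPow (ha : 0 < a) (m : ℝ) (i : Fin n) :
    coordDeriv i (radialPow a m) = fun x => -2 * m * (x i * radialPow a (m + 1) x) := by
  ext x
  have h1 : HasFDerivAt (fun x : EuclideanSpace ℝ (Fin n) => ‖x‖ ^ 2 + a)
      (2 • (innerSL ℝ x)) x := ((hasStrictFDerivAt_norm_sq x).hasFDerivAt).add_const a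
  have h2 := h1.rpow_const (p := -m) (Or.inl (by positivity))
  have h3 : coordDeriv i (radialPow a m) x = _ :=
    congrArg (fun L => L (EuclideanSpace.single i 1)) h2.fderiv
  rw [h3, radialPow, neg_add, ← sub_eq_add_neg]
  simp [EuclideanSpace.inner_single_right]
  ring

theorem coordDeriv_coordDeriv_radialPow (ha : 0 < a) (m : ℝ) (i : Fin n) :
    coordDeriv i (coordDeriv i (radialPow a m)) = fun x =>
      -2 * m * radialPow a (m + 1) x + 4 * m * (m + 1) * (x i ^ 2 * radialPow a (m + 2) x) := by
  rw [coordDeriv_radialPow ha]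
  ext x
  have h1 : HasFDerivAt (fun x : EuclideanSpace ℝ (Fin n) => x i)
      (EuclideanSpace.proj i : EuclideanSpace ℝ (Fin n) →L[ℝ] ℝ) x :=
    (EuclideanSpace.proj i : EuclideanSpace ℝ (Fin n) →L[ℝ] ℝ).hasFDerivAt
  have h2 : HasFDerivAt (radialPow (n := n) a (m + 1)) _ x :=
    ((contDiff_radialPow (k := 1) ha (m + 1)).differentiable one_ne_zero x).hasFDerivAt
  have h4 : fderiv ℝ (radialPow a (m + 1)) x (EuclideanSpace.single i 1) =
      -2 * (m + 1) * (x i * radialPow a (m + 1 + 1) x) :=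
    congrFun (coordDeriv_radialPow ha (m + 1) i) x
  have h3 := ((h1.mul h2).const_mul (-2 * m)).fderiv
  have h5 := congrArg (fun L => L (EuclideanSpace.single i 1)) h3
  refine Eq.trans h5 ?_
  simp [h4, show m + 1 + 1 = m + 2 by ring]
  ring

theorem radialPow_eq_mul (ha : 0 < a) (m : ℝ) (x : EuclideanSpace ℝ (Fin n)) :
    radialPow a m x = (‖x‖ ^ 2 + a) * radialPow a (m + 1) x := by
  have hp : 0 < ‖x‖ ^ 2 + a := by positivity
  rw [radialPow, radialPow, show -m = 1 + -(m + 1) by ring, rpow_add hp, rpow_one]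

theorem laplacian_radialPow (ha : 0 < a) (m : ℝ) (x : EuclideanSpace ℝ (Fin n)) :
    -laplacian (radialPow a m) x =
      2 * m * (n - 2 * m - 2) * radialPow a (m + 1) x +
        4 * m * (m + 1) * a * radialPow a (m + 2) x := by
  rw [laplacian_eq_sum_coordDeriv]
  simp only [coordDeriv_coordDeriv_radialPow ha]
  rw [Finset.sum_add_distrib, ← Finset.mul_sum, ← Finset.mul_sum, ← Finset.sum_mul,
    ← EuclideanSpace.real_norm_sq_eq, Finset.sum_const, Finset.card_univ, Fintype.card_fin, nsmul_eq_mul,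
    radialPow_eq_mul ha (m + 1), show m + 1 + 1 = m + 2 by ring]
  ring

theorem min_one_mul_le (a : ℝ) (x : EuclideanSpace ℝ (Fin n)) :
    min a 1 * (1 + ‖x‖ ^ 2) ≤ ‖x‖ ^ 2 + a := by
  nlinarith [min_le_left a 1, min_le_right a 1, sq_nonneg ‖x‖,
    mul_le_mul_of_nonneg_right (min_le_right a 1) (sq_nonneg ‖x‖)]

theorem powDecay_radialPow (ha : 0 < a) (hm : 0 ≤ m) :
    PowDecay m (radialPow (n := n) a m) := by
  have hc : 0 < min a 1 := lt_min ha one_pos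
  refine ⟨(min a 1) ^ (-m), fun x => ?_⟩
  rw [abs_of_nonneg (radialPow_nonneg ha.le x), ← mul_rpow hc.le (by positivity)]
  exact rpow_le_rpow_of_nonpos (by positivity) (min_one_mul_le a x) (by linarith)

theorem powDecay_radialPow_sub (ha : 0 < a) (hb : 0 < b) (hm : 0 ≤ m) :
    PowDecay (m + 1) (fun x : EuclideanSpace ℝ (Fin n) => radialPow a m x - radialPow b m x) := by
  set c := min a b with hcdef
  have hc : 0 < c := lt_min ha hb
  refine ((powDecay_radialPow hc (by linarith : 0 ≤ m + 1)).const_mul (m * |a - b|)).of_abs_le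
    fun x => ?_
  have h1 : ∀ t ∈ Set.Ici c, HasDerivWithinAt (fun t : ℝ => (‖x‖ ^ 2 + t) ^ (-m))
      (1 * -m * (‖x‖ ^ 2 + t) ^ (-m - 1)) (Set.Ici c) t := fun t ht =>
    (((hasDerivAt_id t).const_add (‖x‖ ^ 2)).rpow_const (p := -m)
      (Or.inl (by have : 0 < t := hc.trans_le ht; positivity))).hasDerivWithinAt
  have h2 : ∀ t ∈ Set.Ici c, ‖1 * -m * (‖x‖ ^ 2 + t) ^ (-m - 1)‖ ≤ m * radialPow c (m + 1) x := by
    intro t ht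
    have ht0 : 0 < t := hc.trans_le ht
    have htc : c ≤ t := ht
    rw [norm_mul, Real.norm_eq_abs, Real.norm_eq_abs, one_mul, abs_neg, abs_of_nonneg hm,
      abs_of_nonneg (by positivity), radialPow, neg_add, sub_eq_add_neg]
    exact mul_le_mul_of_nonneg_left
      (rpow_le_rpow_of_nonpos (by positivity) (by linarith) (by linarith)) hm
  have h3 := Convex.norm_image_sub_le_of_norm_hasDerivWithin_le h1 h2 (convex_Ici c)
    (x := b) (y := a) (min_le_right a b) (min_le_left a b)
  rw [Real.norm_eq_abs, Real.norm_eq_abs] at h3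
  have h4 : 0 ≤ m * |a - b| * radialPow c (m + 1) x :=
    mul_nonneg (by positivity) (radialPow_nonneg hc.le x)
  rw [abs_of_nonneg h4]
  exact h3.trans_eq (by ring)

theorem powDecay_coord (i : Fin n) : PowDecay (-1) (fun x => x i) := by
  refine ⟨1, fun x => ?_⟩
  have h := PiLp.norm_apply_le x i
  rw [Real.norm_eq_abs] at h
  rw [neg_neg, rpow_one]
  nlinarith [sq_nonneg (‖x‖ - 1), sq_nonneg ‖x‖]

theorem powDecay_coord_sq (i : Fin n) : PowDecay (-1) (fun x => x i ^ 2) := by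
  refine ⟨1, fun x => ?_⟩
  have h := PiLp.norm_apply_le x i
  rw [Real.norm_eq_abs] at h
  rw [neg_neg, rpow_one, abs_pow]
  nlinarith [pow_le_pow_left₀ (abs_nonneg _) h 2]

theorem decaysC2_radialPow (ha : 0 < a) (hm : 0 ≤ m) : DecaysC2 m (radialPow (n := n) a m) where
  contDiff := contDiff_radialPow ha m
  decay := powDecay_radialPow ha hm
  decay_coordDeriv i := by
    rw [coordDeriv_radialPow ha]
    exact (((powDecay_coord i).mul (powDecay_radialPow ha (by linarith : 0 ≤ m + 1))).const_mul
      _).mono (by linarith)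
  decay_coordDeriv₂ i := by
    rw [coordDeriv_coordDeriv_radialPow ha]
    exact (((powDecay_radialPow ha (by linarith : 0 ≤ m + 1)).const_mul _).mono
      (by linarith)).add ((((powDecay_coord_sq i).mul
        (powDecay_radialPow ha (by linarith : 0 ≤ m + 2))).const_mul _).mono (by linarith))

theorem coordDeriv_sub {W G : EuclideanSpace ℝ (Fin n) → ℝ} (hW : Differentiable ℝ W)
    (hG : Differentiable ℝ G) (i : Fin n) :
    coordDeriv i (fun x => W x - G x) = fun x => coordDeriv i W x - coordDeriv i G x := by
  ext x
  simp only [coordDeriv]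
  rw [fderiv_fun_sub (hW x) (hG x)]
  rfl

theorem coordDeriv_coordDeriv_sub {W G : EuclideanSpace ℝ (Fin n) → ℝ} (hW : ContDiff ℝ 2 W)
    (hG : ContDiff ℝ 2 G) (i : Fin n) :
    coordDeriv i (coordDeriv i (fun x => W x - G x)) = fun x =>
      coordDeriv i (coordDeriv i W) x - coordDeriv i (coordDeriv i G) x := by
  rw [coordDeriv_sub (hW.differentiable two_ne_zero) (hG.differentiable two_ne_zero),
    coordDeriv_sub ((ContDiff.coordDeriv (k := 1) hW i).differentiable one_ne_zero)
      ((ContDiff.coordDeriv (k := 1) hG i).differentiable one_ne_zero)]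

theorem laplacian_sub {W G : EuclideanSpace ℝ (Fin n) → ℝ} (hW : ContDiff ℝ 2 W)
    (hG : ContDiff ℝ 2 G) (x : EuclideanSpace ℝ (Fin n)) :
    laplacian (fun x => W x - G x) x = laplacian W x - laplacian G x := by
  simp only [laplacian_eq_sum_coordDeriv, coordDeriv_coordDeriv_sub hW hG, Finset.sum_sub_distrib]

theorem decaysC2_radialPow_sub (ha : 0 < a) (hb : 0 < b) (hm : 0 ≤ m) :
    DecaysC2 (m + 1) (fun x : EuclideanSpace ℝ (Fin n) => radialPow a m x - radialPow b m x) where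
  contDiff := (contDiff_radialPow ha m).sub (contDiff_radialPow hb m)
  decay := powDecay_radialPow_sub ha hb hm
  decay_coordDeriv i := by
    rw [coordDeriv_sub ((contDiff_radialPow (k := 1) ha m).differentiable one_ne_zero)
      ((contDiff_radialPow (k := 1) hb m).differentiable one_ne_zero), coordDeriv_radialPow ha,
      coordDeriv_radialPow hb]
    simp only [← mul_sub]
    exact (((powDecay_coord i).mul
      (powDecay_radialPow_sub ha hb (by linarith : 0 ≤ m + 1))).const_mul _).mono (by linarith)
  decay_coordDeriv₂ i := by
    rw [coordDeriv_coordDeriv_sub (contDiff_radialPow ha m) (contDiff_radialPow hb m),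
      coordDeriv_coordDeriv_radialPow ha, coordDeriv_coordDeriv_radialPow hb]
    simp only [add_sub_add_comm, ← mul_sub]
    exact (((powDecay_radialPow_sub ha hb (by linarith : 0 ≤ m + 1)).const_mul _).mono
      (by linarith)).add ((((powDecay_coord_sq i).mul
        (powDecay_radialPow_sub ha hb (by linarith : 0 ≤ m + 2))).const_mul _).mono (by linarith))

end radialPow

/-- The total mass of `-Δ ‖·‖^(2-n)`. -/
noncomputable def newtonMass (n : ℕ) : ℝ :=
  n * (n - 2) * ∫ z : EuclideanSpace ℝ (Fin n), radialPow 1 ((n : ℝ) / 2 + 1) z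

/-- A bounded decaying approximation of `‖z‖^(2-n)`, increasing in `k`. -/
noncomputable def newtonApprox (k : ℕ) (z : EuclideanSpace ℝ (Fin n)) : ℝ :=
  radialPow ((((k : ℝ) + 1)⁻¹) ^ 2) ((n : ℝ) / 2 - 1) z -
    radialPow (((k : ℝ) + 1) ^ 2) ((n : ℝ) / 2 - 1) z

theorem integrable_radialPow_one :
    Integrable (radialPow (n := n) 1 ((n : ℝ) / 2 + 1)) :=
  (powDecay_radialPow one_pos (by positivity)).integrable
    (contDiff_radialPow (k := 0) one_pos _).continuous.aestronglyMeasurable (by linarith)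

theorem newtonMass_pos (hn : 2 < n) : 0 < newtonMass n := by
  have h2 : (2 : ℝ) < n := by exact_mod_cast hn
  refine mul_pos (mul_pos (by linarith) (by linarith)) ?_
  rw [integral_pos_iff_support_of_nonneg (fun z => radialPow_nonneg zero_le_one z)
    integrable_radialPow_one]
  have h : Function.support (radialPow (n := n) 1 ((n : ℝ) / 2 + 1)) = Set.univ := by
    ext z
    simp only [Function.mem_support, Set.mem_univ, iff_true]
    have : 0 < radialPow 1 ((n : ℝ) / 2 + 1) z := by unfold radialPow; positivity
    exact this.ne'
  rw [h]
  exact Measure.measure_univ_pos.2 (NeZero.ne _)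

theorem neg_laplacian_radialPow_newton {a : ℝ} (ha : 0 < a) (x : EuclideanSpace ℝ (Fin n)) :
    -laplacian (radialPow a ((n : ℝ) / 2 - 1)) x =
      n * (n - 2) * (a * radialPow a ((n : ℝ) / 2 + 1) x) := by
  rw [laplacian_radialPow ha, show (n : ℝ) / 2 - 1 + 2 = n / 2 + 1 by ring]
  ring

theorem integral_radialPow_mul_eq {r : ℝ} (hr : 0 < r) (W : EuclideanSpace ℝ (Fin n) → ℝ) :
    ∫ x, (r ^ 2 * radialPow (r ^ 2) ((n : ℝ) / 2 + 1) x) * W x =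
      ∫ z, radialPow 1 ((n : ℝ) / 2 + 1) z * W (r • z) := by
  have h := Measure.integral_comp_smul (volume : Measure (EuclideanSpace ℝ (Fin n)))
    (fun x => (r ^ 2 * radialPow (r ^ 2) ((n : ℝ) / 2 + 1) x) * W x) r
  have e : ∀ z : EuclideanSpace ℝ (Fin n),
      r ^ 2 * radialPow (r ^ 2) ((n : ℝ) / 2 + 1) (r • z) =
        (r ^ n)⁻¹ * radialPow 1 ((n : ℝ) / 2 + 1) z := by
    intro z
    have h1 : ‖r • z‖ ^ 2 + r ^ 2 = r ^ 2 * (‖z‖ ^ 2 + 1) := by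
      rw [norm_smul, Real.norm_eq_abs, mul_pow, sq_abs]
      ring
    have h2 : (r ^ 2) ^ (-((n : ℝ) / 2 + 1)) = (r ^ n)⁻¹ * (r ^ 2)⁻¹ := by
      rw [← rpow_natCast r 2, ← rpow_mul hr.le, ← rpow_natCast r n, ← rpow_neg hr.le,
        ← rpow_neg hr.le, ← rpow_add hr]
      congr 1
      push_cast
      ring
    rw [radialPow, radialPow, h1, mul_rpow (by positivity) (by positivity), h2]
    field_simp
  simp only [e, finrank_euclideanSpace, Fintype.card_fin, smul_eq_mul, mul_assoc] at h
  rw [integral_const_mul, abs_of_pos (by positivity)] at h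
  simp only [mul_assoc]
  exact (mul_left_cancel₀ (by positivity) h).symm

theorem tendsto_integral_radialPow_mul {W : EuclideanSpace ℝ (Fin n) → ℝ} (hc : Continuous W)
    {D c : ℝ} (hD : ∀ z, |W z| ≤ D) {r : ℕ → ℝ}
    (h : ∀ z ≠ 0, Tendsto (fun k => W (r k • z)) atTop (𝓝 c)) (hn : n ≠ 0) :
    Tendsto (fun k => ∫ z, radialPow 1 ((n : ℝ) / 2 + 1) z * W (r k • z)) atTop
      (𝓝 ((∫ z : EuclideanSpace ℝ (Fin n), radialPow 1 ((n : ℝ) / 2 + 1) z) * c)) := by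
  have : NeZero n := ⟨hn⟩
  rw [← integral_mul_const]
  have hcr : Continuous (radialPow (n := n) 1 ((n : ℝ) / 2 + 1)) :=
    (contDiff_radialPow (k := 0) one_pos _).continuous
  refine tendsto_integral_of_dominated_convergence
    (fun z => radialPow 1 ((n : ℝ) / 2 + 1) z * D)
    (fun k => (hcr.mul (hc.comp (continuous_const_smul _))).aestronglyMeasurable)
    (integrable_radialPow_one.mul_const D) (fun k => ae_of_all _ fun z => ?_) ?_
  · rw [norm_mul, Real.norm_eq_abs, Real.norm_eq_abs, abs_of_nonneg (radialPow_nonneg zero_le_one z)]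
    exact mul_le_mul_of_nonneg_left (hD _) (radialPow_nonneg zero_le_one z)
  · filter_upwards [Measure.ae_ne volume (0 : EuclideanSpace ℝ (Fin n))] with z hz
    exact (h z hz).const_mul _

theorem PowDecay.bounded {γ : ℝ} {W : EuclideanSpace ℝ (Fin n) → ℝ} (hW : PowDecay γ W)
    (hγ : 0 ≤ γ) : ∃ D, ∀ z, |W z| ≤ D := by
  obtain ⟨D, hD⟩ := hW.mono hγ
  exact ⟨D, fun z => by simpa using hD z⟩

theorem tendsto_integral_newtonApprox_mul (hn : 2 < n) {γ : ℝ} (hγ : 0 < γ)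
    {W : EuclideanSpace ℝ (Fin n) → ℝ} (hW : DecaysC2 γ W) :
    Tendsto (fun k : ℕ => ∫ z, newtonApprox k z * (-laplacian W z)) atTop
      (𝓝 (newtonMass n * W 0)) := by
  have h2 : (2 : ℝ) < n := by exact_mod_cast hn
  have hm : 0 ≤ (n : ℝ) / 2 - 1 := by linarith
  have hWc := hW.continuous
  obtain ⟨D, hD⟩ := hW.decay.bounded hγ.le
  have hr : Tendsto (fun k : ℕ => (k : ℝ) + 1) atTop atTop :=
    tendsto_atTop_add_const_right _ _ tendsto_natCast_atTop_atTop
  have hint : ∀ a : ℝ, 0 < a → Integrable (fun z : EuclideanSpace ℝ (Fin n) =>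
      (a * radialPow a ((n : ℝ) / 2 + 1) z) * W z) := fun a ha =>
    (((powDecay_radialPow ha (by linarith)).const_mul a).mul hW.decay).integrable
      ((((contDiff_radialPow (k := 0) ha _).continuous).const_mul a).mul
        hWc).aestronglyMeasurable (by linarith)
  have key : ∀ k : ℕ, ∫ z, newtonApprox k z * (-laplacian W z) =
      n * (n - 2) * ((∫ z, radialPow 1 ((n : ℝ) / 2 + 1) z * W (((k : ℝ) + 1)⁻¹ • z)) -
        ∫ z, radialPow 1 ((n : ℝ) / 2 + 1) z * W (((k : ℝ) + 1) • z)) := by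
    intro k
    have hb : 0 < (k : ℝ) + 1 := by positivity
    have ha : 0 < ((k : ℝ) + 1)⁻¹ := by positivity
    have hG := decaysC2_radialPow_sub (n := n) (pow_pos ha 2) (pow_pos hb 2) hm
    have hI := hG.integral_mul_laplacian hW (by linarith)
    rw [← integral_radialPow_mul_eq ha, ← integral_radialPow_mul_eq hb,
      ← integral_sub (hint _ (pow_pos ha 2)) (hint _ (pow_pos hb 2)), ← integral_const_mul]
    simp only [newtonApprox, mul_neg, integral_neg]
    rw [hI, ← integral_neg]
    congr 1
    ext z
    rw [laplacian_sub (contDiff_radialPow (pow_pos ha 2) _) (contDiff_radialPow (pow_pos hb 2) _)]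
    have e1 := neg_laplacian_radialPow_newton (pow_pos ha 2) z
    have e2 := neg_laplacian_radialPow_newton (pow_pos hb 2) z
    linear_combination W z * e1 - W z * e2
  simp only [key]
  have t1 := tendsto_integral_radialPow_mul hWc hD (r := fun k : ℕ => ((k : ℝ) + 1)⁻¹) (c := W 0)
    (fun z _ => by
      have h := (tendsto_inv_atTop_zero.comp hr).smul_const z
      rw [zero_smul] at h
      exact (hWc.tendsto 0).comp h) (by omega)
  have t2 := tendsto_integral_radialPow_mul hWc hD (r := fun k : ℕ => (k : ℝ) + 1) (c := 0)
    (fun z hz => by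
      refine (hW.decay.tendsto_cocompact hγ).comp ?_
      rw [← Metric.cobounded_eq_cocompact, ← tendsto_norm_atTop_iff_cobounded]
      have h := hr.atTop_mul_const (norm_pos_iff.2 hz)
      refine h.congr fun k => ?_
      rw [norm_smul, Real.norm_of_nonneg (by positivity)]) (by omega)
  have h := (t1.sub t2).const_mul ((n : ℝ) * (n - 2))
  rw [mul_zero, sub_zero, ← mul_assoc] at h
  exact h

theorem newtonApprox_nonneg (hn : 2 < n) (k : ℕ) (z : EuclideanSpace ℝ (Fin n)) :
    0 ≤ newtonApprox k z := by
  have h2 : (2 : ℝ) < n := by exact_mod_cast hn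
  have hk : (1 : ℝ) ≤ k + 1 := by simp
  refine sub_nonneg.2 (rpow_le_rpow_of_nonpos (by positivity) ?_ (by linarith))
  have h3 : ((k : ℝ) + 1)⁻¹ ≤ k + 1 := (inv_le_one_of_one_le₀ hk).trans hk
  gcongr

theorem newtonApprox_le (hn : 2 < n) (k : ℕ) {z : EuclideanSpace ℝ (Fin n)} (hz : z ≠ 0) :
    newtonApprox k z ≤ radialPow 0 ((n : ℝ) / 2 - 1) z := by
  have h2 : (2 : ℝ) < n := by exact_mod_cast hn
  have hz' : 0 < ‖z‖ := norm_pos_iff.2 hz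
  refine (sub_le_self _ (radialPow_nonneg (by positivity) z)).trans ?_
  refine rpow_le_rpow_of_nonpos (by positivity) ?_ (by linarith)
  have : 0 ≤ (((k : ℝ) + 1)⁻¹) ^ 2 := by positivity
  linarith

theorem tendsto_newtonApprox (hn : 2 < n) {z : EuclideanSpace ℝ (Fin n)} (hz : z ≠ 0) :
    Tendsto (fun k => newtonApprox k z) atTop (𝓝 (radialPow 0 ((n : ℝ) / 2 - 1) z)) := by
  have h2 : (2 : ℝ) < n := by exact_mod_cast hn
  have hz' : 0 < ‖z‖ := norm_pos_iff.2 hz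
  have hr : Tendsto (fun k : ℕ => (k : ℝ) + 1) atTop atTop :=
    tendsto_atTop_add_const_right _ _ tendsto_natCast_atTop_atTop
  have t1 : Tendsto (fun k : ℕ => ‖z‖ ^ 2 + (((k : ℝ) + 1)⁻¹) ^ 2) atTop (𝓝 (‖z‖ ^ 2 + 0)) := by
    have h := (tendsto_inv_atTop_zero.comp hr).pow 2
    rw [zero_pow two_ne_zero] at h
    exact h.const_add _
  have t2 : Tendsto (fun k : ℕ => ‖z‖ ^ 2 + ((k : ℝ) + 1) ^ 2) atTop atTop :=
    tendsto_atTop_add_const_left _ _ ((tendsto_pow_atTop two_ne_zero).comp hr)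
  have h := (t1.rpow_const (p := -((n : ℝ) / 2 - 1)) (Or.inl (by positivity))).sub
    ((tendsto_rpow_neg_atTop (by linarith : 0 < (n : ℝ) / 2 - 1)).comp t2)
  rw [sub_zero] at h
  exact h

theorem continuous_newtonApprox (k : ℕ) : Continuous (newtonApprox (n := n) k) :=
  ((contDiff_radialPow (k := 0) (by positivity) _).sub
    (contDiff_radialPow (k := 0) (by positivity) _)).continuous

theorem measurable_radialPow (a m : ℝ) : Measurable (radialPow (n := n) a m) :=
  ((measurable_norm.pow_const 2).add_const a).pow_const _

/-- The Newtonian potential inverts `-Δ` on decaying functions. -/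
theorem integral_newton_mul_neg_laplacian (hn : 2 < n) {γ : ℝ} (hγ : 0 < γ)
    {W : EuclideanSpace ℝ (Fin n) → ℝ} (hW : DecaysC2 γ W)
    (hi : Integrable (fun z => radialPow 0 ((n : ℝ) / 2 - 1) z * (-laplacian W z))) :
    ∫ z, radialPow 0 ((n : ℝ) / 2 - 1) z * (-laplacian W z) = newtonMass n * W 0 := by
  have : NeZero n := ⟨by omega⟩
  refine tendsto_nhds_unique ?_ (tendsto_integral_newtonApprox_mul hn hγ hW)
  refine tendsto_integral_of_dominated_convergence _ (fun k =>
    ((continuous_newtonApprox k).mul hW.continuous_laplacian.neg).aestronglyMeasurable)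
    hi.norm (fun k => ?_) ?_
  · filter_upwards [Measure.ae_ne volume (0 : EuclideanSpace ℝ (Fin n))] with z hz
    rw [norm_mul, norm_mul, Real.norm_of_nonneg (newtonApprox_nonneg hn k z),
      Real.norm_of_nonneg (radialPow_nonneg le_rfl z)]
    exact mul_le_mul_of_nonneg_right (newtonApprox_le hn k hz) (norm_nonneg _)
  · filter_upwards [Measure.ae_ne volume (0 : EuclideanSpace ℝ (Fin n))] with z hz
    exact (tendsto_newtonApprox hn hz).mul_const _

theorem integrable_newton_mul_neg_laplacian (hn : 2 < n) {γ : ℝ} (hγ : 0 < γ)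
    {W : EuclideanSpace ℝ (Fin n) → ℝ} (hW : DecaysC2 γ W) (h0 : ∀ z, 0 ≤ -laplacian W z) :
    Integrable (fun z => radialPow 0 ((n : ℝ) / 2 - 1) z * (-laplacian W z)) := by
  have : NeZero n := ⟨by omega⟩
  have h2 : (2 : ℝ) < n := by exact_mod_cast hn
  have hcL := hW.continuous_laplacian
  refine ⟨((measurable_radialPow _ _).mul hcL.neg.measurable).aestronglyMeasurable, ?_⟩
  rw [hasFiniteIntegral_iff_ofReal (ae_of_all _ fun z => mul_nonneg (radialPow_nonneg le_rfl z)
    (h0 z))]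
  have hint : ∀ k, Integrable (fun z => newtonApprox k z * (-laplacian W z)) := fun k => by
    refine ((powDecay_radialPow_sub (n := n) (by positivity) (by positivity)
      (by linarith : 0 ≤ (n : ℝ) / 2 - 1)).mul
        (PowDecay.neg (PowDecay.finset_sum Finset.univ hW.decay_coordDeriv₂))).integrable
      ((continuous_newtonApprox k).mul hcL.neg).aestronglyMeasurable (by linarith)
  have ht : Tendsto (fun k : ℕ => ∫⁻ z, ENNReal.ofReal (newtonApprox k z * (-laplacian W z)))
      atTop (𝓝 (ENNReal.ofReal (newtonMass n * W 0))) := by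
    refine (ENNReal.tendsto_ofReal (tendsto_integral_newtonApprox_mul hn hγ hW)).congr fun k => ?_
    exact ofReal_integral_eq_lintegral_ofReal (hint k)
      (ae_of_all _ fun z => mul_nonneg (newtonApprox_nonneg hn k z) (h0 z))
  calc ∫⁻ z, ENNReal.ofReal (radialPow 0 ((n : ℝ) / 2 - 1) z * (-laplacian W z))
      = ∫⁻ z, liminf (fun k : ℕ => ENNReal.ofReal (newtonApprox k z * (-laplacian W z)))
          atTop := by
        refine lintegral_congr_ae ?_
        filter_upwards [Measure.ae_ne volume (0 : EuclideanSpace ℝ (Fin n))] with z hz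
        exact (ENNReal.tendsto_ofReal ((tendsto_newtonApprox hn hz).mul_const _)).liminf_eq.symm
    _ ≤ liminf (fun k : ℕ => ∫⁻ z, ENNReal.ofReal (newtonApprox k z * (-laplacian W z))) atTop :=
        lintegral_liminf_le fun k =>
          ((continuous_newtonApprox k).mul hcL.neg).measurable.ennreal_ofReal
    _ = ENNReal.ofReal (newtonMass n * W 0) := ht.liminf_eq
    _ < ⊤ := ENNReal.ofReal_lt_top

section potential

variable {α C : ℝ} {f : EuclideanSpace ℝ (Fin n) → ℝ}

theorem exists_integral_newton_mul_radialPow_le (hn : 2 < n) (hα0 : 0 < α)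
    (hα1 : α < (n : ℝ) / 2 - 1) :
    ∃ B > 0, ∀ x : EuclideanSpace ℝ (Fin n),
      Integrable (fun z => radialPow 0 ((n : ℝ) / 2 - 1) z * radialPow 1 (α + 1) (x + z)) ∧
      ∫ z, radialPow 0 ((n : ℝ) / 2 - 1) z * radialPow 1 (α + 1) (x + z) ≤
        B * radialPow 1 α x := by
  set c := 2 * α * (n - 2 * α - 2) with hcdef
  have hc : 0 < c := mul_pos (by linarith) (by linarith)
  refine ⟨newtonMass n / c, div_pos (newtonMass_pos hn) hc, fun x => ?_⟩
  have hU := (decaysC2_radialPow (n := n) one_pos hα0.le).comp_add_left hα0.le x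
  have hL : ∀ z, c * radialPow 1 (α + 1) (x + z) ≤
      -laplacian (fun z => radialPow 1 α (x + z)) z := by
    intro z
    rw [laplacian_comp_add_left, laplacian_radialPow one_pos]
    have := mul_nonneg (by positivity : 0 ≤ 4 * α * (α + 1) * 1)
      (radialPow_nonneg (m := α + 2) zero_le_one (x + z))
    linarith
  have h0 : ∀ z, 0 ≤ -laplacian (fun z => radialPow 1 α (x + z)) z := fun z =>
    (mul_nonneg hc.le (radialPow_nonneg zero_le_one _)).trans (hL z)
  have hi := integrable_newton_mul_neg_laplacian hn hα0 hU h0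
  have he := integral_newton_mul_neg_laplacian hn hα0 hU hi
  have hle : ∀ z, radialPow 0 ((n : ℝ) / 2 - 1) z * radialPow 1 (α + 1) (x + z) ≤
      c⁻¹ * (radialPow 0 ((n : ℝ) / 2 - 1) z *
        (-laplacian (fun z => radialPow 1 α (x + z)) z)) := by
    intro z
    rw [mul_left_comm, ← div_eq_inv_mul]
    refine mul_le_mul_of_nonneg_left ?_ (radialPow_nonneg le_rfl z)
    rw [le_div_iff₀' hc]
    exact hL z
  have hi' : Integrable
      (fun z => radialPow 0 ((n : ℝ) / 2 - 1) z * radialPow 1 (α + 1) (x + z)) := by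
    refine (hi.const_mul c⁻¹).mono' ((measurable_radialPow _ _).mul
      ((measurable_radialPow _ _).comp (measurable_const_add x))).aestronglyMeasurable
      (ae_of_all _ fun z => ?_)
    rw [Real.norm_of_nonneg (mul_nonneg (radialPow_nonneg le_rfl z)
      (radialPow_nonneg zero_le_one _))]
    exact hle z
  refine ⟨hi', (integral_mono hi' (hi.const_mul _) hle).trans_eq ?_⟩
  rw [integral_const_mul, he, add_zero]
  ring

theorem integrable_newton_mul_comp_add (hn : 2 < n) (hα0 : 0 < α) (hα1 : α < (n : ℝ) / 2 - 1)
    (hf : Continuous f) (hfb : ∀ x, |f x| ≤ C * radialPow 1 (α + 1) x)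
    (x : EuclideanSpace ℝ (Fin n)) :
    Integrable (fun z => radialPow 0 ((n : ℝ) / 2 - 1) z * f (x + z)) := by
  obtain ⟨B, -, hB⟩ := exists_integral_newton_mul_radialPow_le hn hα0 hα1
  refine ((hB x).1.const_mul C).mono' ((measurable_radialPow _ _).mul
    (hf.comp (continuous_const_add x)).measurable).aestronglyMeasurable (ae_of_all _ fun z => ?_)
  rw [norm_mul, Real.norm_of_nonneg (radialPow_nonneg le_rfl z), mul_left_comm]
  exact mul_le_mul_of_nonneg_left (hfb _) (radialPow_nonneg le_rfl z)

theorem exists_abs_integral_newton_mul_le (hn : 2 < n) (hα0 : 0 < α) (hα1 : α < (n : ℝ) / 2 - 1)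
    (hfb : ∀ x, |f x| ≤ C * radialPow 1 (α + 1) x) :
    ∃ B > 0, ∀ x, |∫ z, radialPow 0 ((n : ℝ) / 2 - 1) z * f (x + z)| ≤ B * radialPow 1 α x := by
  obtain ⟨B, hB0, hB⟩ := exists_integral_newton_mul_radialPow_le hn hα0 hα1
  refine ⟨(|C| + 1) * B, by positivity, fun x => ?_⟩
  have h1 : |∫ z, radialPow 0 ((n : ℝ) / 2 - 1) z * f (x + z)| ≤
      ∫ z, |C| * (radialPow 0 ((n : ℝ) / 2 - 1) z * radialPow 1 (α + 1) (x + z)) := by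
    rw [← Real.norm_eq_abs]
    refine norm_integral_le_of_norm_le ((hB x).1.const_mul _) (ae_of_all _ fun z => ?_)
    rw [norm_mul, Real.norm_of_nonneg (radialPow_nonneg le_rfl z), mul_left_comm]
    exact mul_le_mul_of_nonneg_left ((hfb _).trans (mul_le_mul_of_nonneg_right (le_abs_self C)
      (radialPow_nonneg zero_le_one _))) (radialPow_nonneg le_rfl z)
  rw [integral_const_mul] at h1
  have h2 := mul_le_mul_of_nonneg_left (hB x).2 (abs_nonneg C)
  have h3 : 0 ≤ B * radialPow 1 α x := mul_nonneg hB0.le (radialPow_nonneg zero_le_one x)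
  linarith

theorem continuous_integral_newton_mul (hn : 2 < n) (hα0 : 0 < α) (hα1 : α < (n : ℝ) / 2 - 1)
    (hf : Continuous f) (hfb : ∀ x, |f x| ≤ C * radialPow 1 (α + 1) x) :
    Continuous fun x => ∫ z, radialPow 0 ((n : ℝ) / 2 - 1) z * f (x + z) := by
  obtain ⟨B, -, hB⟩ := exists_integral_newton_mul_radialPow_le hn hα0 hα1
  have hB0 := (hB 0).1
  simp only [zero_add] at hB0
  refine continuous_iff_continuousAt.2 fun x₀ => ?_
  refine continuousAt_of_dominated (bound := fun z => |C| * (2 * (1 + (‖x₀‖ + 1) ^ 2)) ^ (α + 1) *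
      (radialPow 0 ((n : ℝ) / 2 - 1) z * radialPow 1 (α + 1) z))
    (Eventually.of_forall fun x => ((measurable_radialPow _ _).mul
      (hf.comp (continuous_const_add x)).measurable).aestronglyMeasurable) ?_
    (hB0.const_mul _) (ae_of_all _ fun z => by fun_prop)
  filter_upwards [Metric.ball_mem_nhds x₀ one_pos] with x hx
  refine ae_of_all _ fun z => ?_
  have hx' : ‖x‖ ≤ ‖x₀‖ + 1 := by
    have h1 := norm_le_norm_add_norm_sub' x x₀
    have h2 := mem_ball_iff_norm.1 hx
    linarith
  have h1 := PowDecay.rpow_add_left_le (by linarith : 0 ≤ α + 1) x z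
  have h2 : (2 * (1 + ‖x‖ ^ 2)) ^ (α + 1) ≤ (2 * (1 + (‖x₀‖ + 1) ^ 2)) ^ (α + 1) := by
    gcongr
  have h3 : |f (x + z)| ≤
      |C| * ((2 * (1 + (‖x₀‖ + 1) ^ 2)) ^ (α + 1) * radialPow 1 (α + 1) z) := by
    refine (hfb _).trans (mul_le_mul (le_abs_self C) ?_ (radialPow_nonneg zero_le_one _)
      (abs_nonneg C))
    rw [radialPow, radialPow, add_comm (‖x + z‖ ^ 2), add_comm (‖z‖ ^ 2)]
    exact h1.trans (mul_le_mul_of_nonneg_right h2 (by positivity))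
  rw [norm_mul, Real.norm_of_nonneg (radialPow_nonneg le_rfl z)]
  exact (mul_le_mul_of_nonneg_left h3 (radialPow_nonneg le_rfl z)).trans_eq (by ring)

theorem abs_le_radialPow_of_hasCompactSupport {g : EuclideanSpace ℝ (Fin n) → ℝ}
    (hc : Continuous g) (hs : HasCompactSupport g) (α : ℝ) :
    ∃ C, ∀ x, |g x| ≤ C * radialPow 1 (α + 1) x := by
  obtain ⟨D, hD⟩ := PowDecay.of_hasCompactSupport hc hs (α + 1)
  exact ⟨D, fun x => by simpa only [radialPow, add_comm] using hD x⟩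

theorem HasCompactSupport.laplacian {φ : EuclideanSpace ℝ (Fin n) → ℝ}
    (hs : HasCompactSupport φ) : HasCompactSupport (laplacian φ) := by
  refine HasCompactSupport.intro hs.isCompact (fun x hx => ?_)
  rw [laplacian_eq_sum_coordDeriv]
  refine Finset.sum_eq_zero fun i _ => image_eq_zero_of_notMem_tsupport fun h => hx ?_
  exact (tsupport_fderiv_apply_subset ℝ _).trans (tsupport_fderiv_apply_subset ℝ _) h

theorem integral_potential_mul_neg_laplacian (hn : 2 < n) (hα0 : 0 < α)
    (hα1 : α < (n : ℝ) / 2 - 1) (hf : Continuous f)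
    (hfb : ∀ x, |f x| ≤ C * radialPow 1 (α + 1) x) {φ : EuclideanSpace ℝ (Fin n) → ℝ}
    (hφ : ContDiff ℝ 2 φ) (hs : HasCompactSupport φ) :
    ∫ x, (∫ z, radialPow 0 ((n : ℝ) / 2 - 1) z * f (x + z)) * (-laplacian φ x) =
      newtonMass n * ∫ x, f x * φ x := by
  have hφd := DecaysC2.of_hasCompactSupport hφ hs 1
  have hψ : Continuous fun x => -laplacian φ x := hφd.continuous_laplacian.neg
  have hψs : HasCompactSupport fun x => -laplacian φ x := hs.laplacian.neg
  obtain ⟨C', hC'⟩ := abs_le_radialPow_of_hasCompactSupport hψ hψs α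
  have hshift : ∀ x (g : EuclideanSpace ℝ (Fin n) → ℝ),
      ∫ z, radialPow 0 ((n : ℝ) / 2 - 1) z * g (x + z) =
        ∫ y, radialPow 0 ((n : ℝ) / 2 - 1) (y - x) * g y := fun x g => by
    rw [← integral_add_left_eq_self (fun y => radialPow 0 ((n : ℝ) / 2 - 1) (y - x) * g y) x]
    simp
  have hishift : ∀ x, Integrable (fun y => radialPow 0 ((n : ℝ) / 2 - 1) (y - x) * f y) := by
    intro x
    have h := (integrable_newton_mul_comp_add hn hα0 hα1 hf hfb x).comp_sub_right x
    simpa using h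
  have hinner : ∀ y, ∫ x, radialPow 0 ((n : ℝ) / 2 - 1) (y - x) * (-laplacian φ x) =
      newtonMass n * φ y := by
    intro y
    have hφy := hφd.comp_add_left zero_le_one y
    have h := integral_newton_mul_neg_laplacian hn one_pos hφy (by
      simp only [laplacian_comp_add_left]
      exact integrable_newton_mul_comp_add hn hα0 hα1 hψ hC' y)
    simp only [laplacian_comp_add_left, add_zero] at h
    rw [← h, hshift y (fun x => -laplacian φ x)]
    simp only [radialPow, norm_sub_rev]
  have hint : Integrable (Function.uncurry fun x y : EuclideanSpace ℝ (Fin n) =>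
      radialPow 0 ((n : ℝ) / 2 - 1) (y - x) * f y * (-laplacian φ x)) (volume.prod volume) := by
    have hm : Measurable (Function.uncurry fun x y : EuclideanSpace ℝ (Fin n) =>
        radialPow 0 ((n : ℝ) / 2 - 1) (y - x) * f y * (-laplacian φ x)) :=
      (((measurable_radialPow _ _).comp (measurable_snd.sub measurable_fst)).mul
        (hf.measurable.comp measurable_snd)).mul (hψ.measurable.comp measurable_fst)
    refine (integrable_prod_iff hm.aestronglyMeasurable).2
      ⟨ae_of_all _ fun x => (hishift x).mul_const (-laplacian φ x), ?_⟩
    have e : (fun x => ∫ y, ‖Function.uncurry (fun x y : EuclideanSpace ℝ (Fin n) =>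
        radialPow 0 ((n : ℝ) / 2 - 1) (y - x) * f y * (-laplacian φ x)) (x, y)‖) =
        fun x => (∫ z, radialPow 0 ((n : ℝ) / 2 - 1) z * |f (x + z)|) * ‖-laplacian φ x‖ := by
      ext x
      rw [hshift x (fun y => |f y|), ← integral_mul_const]
      congr 1
      ext y
      rw [Function.uncurry_apply_pair, norm_mul, norm_mul,
        Real.norm_of_nonneg (radialPow_nonneg le_rfl _), Real.norm_eq_abs (f y)]
    rw [e]
    have hc := continuous_integral_newton_mul hn hα0 hα1 hf.abs (f := fun x => |f x|) (C := C)
      (by simpa using hfb)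
    exact (hc.mul hψ.norm).integrable_of_hasCompactSupport hψs.norm.mul_left
  calc ∫ x, (∫ z, radialPow 0 ((n : ℝ) / 2 - 1) z * f (x + z)) * (-laplacian φ x)
      = ∫ x, ∫ y, radialPow 0 ((n : ℝ) / 2 - 1) (y - x) * f y * (-laplacian φ x) := by
        congr 1
        ext x
        rw [hshift x f, integral_mul_const]
    _ = ∫ y, ∫ x, radialPow 0 ((n : ℝ) / 2 - 1) (y - x) * f y * (-laplacian φ x) :=
        integral_integral_swap hint
    _ = ∫ y, newtonMass n * (f y * φ y) := by
        congr 1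
        ext y
        rw [mul_left_comm, ← hinner y, ← integral_const_mul]
        congr 1
        ext x
        ring
    _ = newtonMass n * ∫ x, f x * φ x := integral_const_mul _ _

end potential

section uniqueness

theorem coordDeriv_const_mul {W : EuclideanSpace ℝ (Fin n) → ℝ} (hW : Differentiable ℝ W) (c : ℝ)
    (i : Fin n) : coordDeriv i (fun x => c * W x) = fun x => c * coordDeriv i W x := by
  ext x
  simp only [coordDeriv]
  rw [fderiv_const_mul (hW x)]
  rfl

theorem laplacian_const_mul {W : EuclideanSpace ℝ (Fin n) → ℝ} (hW : ContDiff ℝ 2 W) (c : ℝ)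
    (x : EuclideanSpace ℝ (Fin n)) : laplacian (fun x => c * W x) x = c * laplacian W x := by
  simp only [laplacian_eq_sum_coordDeriv]
  rw [Finset.mul_sum]
  refine Finset.sum_congr rfl fun i _ => ?_
  rw [coordDeriv_const_mul (hW.differentiable two_ne_zero),
    coordDeriv_const_mul ((ContDiff.coordDeriv (k := 1) hW i).differentiable one_ne_zero)]

theorem coordDeriv_comp_const_sub {W : EuclideanSpace ℝ (Fin n) → ℝ} (hW : Differentiable ℝ W)
    (i : Fin n) (x : EuclideanSpace ℝ (Fin n)) :
    coordDeriv i (fun t => W (x - t)) = fun t => -1 * coordDeriv i W (x - t) := by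
  ext t
  have h : HasFDerivAt (fun t => W (x - t)) _ t :=
    (hW (x - t)).hasFDerivAt.comp t ((hasFDerivAt_id t).const_sub x)
  rw [coordDeriv, h.fderiv]
  simp [coordDeriv]

theorem laplacian_comp_const_sub {W : EuclideanSpace ℝ (Fin n) → ℝ} (hW : ContDiff ℝ 2 W)
    (x t : EuclideanSpace ℝ (Fin n)) :
    laplacian (fun t => W (x - t)) t = laplacian W (x - t) := by
  simp only [laplacian_eq_sum_coordDeriv]
  refine Finset.sum_congr rfl fun i _ => ?_
  have h1 : Differentiable ℝ (coordDeriv i W) :=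
    (ContDiff.coordDeriv (k := 1) hW i).differentiable one_ne_zero
  rw [coordDeriv_comp_const_sub (hW.differentiable two_ne_zero),
    coordDeriv_const_mul (W := fun t => coordDeriv i W (x - t))
      (h1.comp (differentiable_id.const_sub x)),
    coordDeriv_comp_const_sub h1]
  ring

theorem IsLocalMax.coordDeriv_coordDeriv_nonpos {g : EuclideanSpace ℝ (Fin n) → ℝ}
    {x : EuclideanSpace ℝ (Fin n)} (hmax : IsLocalMax g x) (hg : ContDiff ℝ 2 g) (i : Fin n) :
    coordDeriv i (coordDeriv i g) x ≤ 0 := by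
  by_contra! hpos
  set e : EuclideanSpace ℝ (Fin n) := EuclideanSpace.single i 1
  have hline : ∀ t : ℝ, HasDerivAt (fun t : ℝ => x + t • e) e t := fun t => by
    simpa using ((hasDerivAt_id t).smul_const e).const_add x
  have hD : ∀ W : EuclideanSpace ℝ (Fin n) → ℝ, Differentiable ℝ W →
      deriv (fun t : ℝ => W (x + t • e)) = fun t => coordDeriv i W (x + t • e) := fun W hW => by
    ext t
    exact ((hW (x + t • e)).hasFDerivAt.comp_hasDerivAt t (hline t)).deriv
  have hd1 := hD g (hg.differentiable two_ne_zero)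
  have hd2 := hD (coordDeriv i g)
    ((ContDiff.coordDeriv (k := 1) hg i).differentiable one_ne_zero)
  have hc : ContinuousAt (fun t : ℝ => x + t • e) 0 := (hline 0).continuousAt
  have hmax' : IsLocalMax (fun t : ℝ => g (x + t • e)) 0 := by
    have h : Tendsto (fun t : ℝ => x + t • e) (𝓝 0) (𝓝 x) := by simpa [ContinuousAt] using hc
    have h' := h.eventually hmax
    simpa [IsLocalMax, IsMaxFilter] using h'
  have hdd : deriv (deriv fun t : ℝ => g (x + t • e)) 0 = coordDeriv i (coordDeriv i g) x := by
    rw [hd1, hd2]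
    simp
  have hmin := isLocalMin_of_deriv_deriv_pos (by rw [hdd]; exact hpos) hmax'.deriv_eq_zero
    (hg.continuous.continuousAt.comp hc)
  have hconst : (fun t : ℝ => g (x + t • e)) =ᶠ[𝓝 0] fun _ => g (x + (0 : ℝ) • e) := by
    filter_upwards [hmax', hmin] with t h1 h2 using le_antisymm h1 h2
  have h0 : deriv (deriv fun t : ℝ => g (x + t • e)) 0 = 0 := by
    rw [hconst.deriv.deriv_eq]
    simp
  rw [hdd] at h0
  exact hpos.ne' h0

/-- The maximum principle on `ℝⁿ` for subharmonic functions vanishing at infinity. -/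
theorem nonpos_of_laplacian_nonneg (hn : n ≠ 0) {v : EuclideanSpace ℝ (Fin n) → ℝ}
    (hv : ContDiff ℝ 2 v) (hlim : Tendsto v (cocompact _) (𝓝 0)) (hL : ∀ x, 0 ≤ laplacian v x)
    (x₀ : EuclideanSpace ℝ (Fin n)) : v x₀ ≤ 0 := by
  by_contra! hpos
  have hev : ∀ᶠ x in cocompact (EuclideanSpace ℝ (Fin n)), v x < v x₀ / 2 :=
    hlim.eventually_lt_const (by linarith)
  rw [← Metric.cobounded_eq_cocompact, ← comap_norm_atTop, eventually_comap] at hev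
  obtain ⟨R, hR⟩ := eventually_atTop.1 hev
  have hR' : ∀ x, R ≤ ‖x‖ → v x < v x₀ / 2 := fun x hx => hR _ hx x rfl
  have hx₀ : ‖x₀‖ < R := by
    by_contra! h
    linarith [hR' x₀ h]
  have hR0 : 0 < R := (norm_nonneg _).trans_lt hx₀
  set δ := v x₀ / (4 * (R ^ 2 + 1)) with hδ
  have hδ0 : 0 < δ := by positivity
  have hq : ContDiff ℝ 2 (radialPow (n := n) 1 (-1)) := contDiff_radialPow one_pos _
  have hqx : ∀ x : EuclideanSpace ℝ (Fin n), radialPow 1 (-1) x = ‖x‖ ^ 2 + 1 := fun x => by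
    simp [radialPow]
  have hg : ContDiff ℝ 2 fun x => v x - -δ * radialPow 1 (-1) x := hv.sub (contDiff_const.mul hq)
  obtain ⟨x₁, hx₁, hmax⟩ := (isCompact_closedBall (0 : EuclideanSpace ℝ (Fin n)) R).exists_isMaxOn
    ⟨x₀, by simpa using hx₀.le⟩ hg.continuous.continuousOn
  have h1 := hmax (show x₀ ∈ Metric.closedBall 0 R by simpa using hx₀.le)
  simp only [Set.mem_ofPred_eq, hqx] at h1
  have hx₁R : ‖x₁‖ < R := by
    refine lt_of_le_of_ne (by simpa using hx₁) fun h => ?_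
    have h2 := hR' x₁ h.ge
    have h3 : δ * (R ^ 2 + 1) = v x₀ / 4 := by
      rw [hδ]
      field_simp
    have h4 : 0 ≤ δ * (‖x₀‖ ^ 2 + 1) := by positivity
    rw [h] at h1
    linarith
  have hloc := hmax.isLocalMax (Metric.closedBall_mem_nhds_of_mem (by simpa using hx₁R))
  have h5 : laplacian (fun x => v x - -δ * radialPow 1 (-1) x) x₁ ≤ 0 :=
    Finset.sum_nonpos fun i _ => hloc.coordDeriv_coordDeriv_nonpos hg i
  rw [laplacian_sub hv (contDiff_const.mul hq), laplacian_const_mul hq] at h5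
  have h6 := laplacian_radialPow (n := n) one_pos (-1) x₁
  have h7 : radialPow 1 (-1 + 1) x₁ = 1 := by simp [radialPow]
  rw [h7] at h6
  have hn0 : (0 : ℝ) < n := by exact_mod_cast Nat.pos_of_ne_zero hn
  have h8 := mul_pos hδ0 hn0
  have h9 : laplacian (radialPow 1 (-1)) x₁ = 2 * n := by linarith
  rw [h9] at h5
  linarith [hL x₁]

open scoped Convolution

theorem coordDeriv_convolution {w ρ : EuclideanSpace ℝ (Fin n) → ℝ} (hw : Continuous w)
    (hρ : ContDiff ℝ 1 ρ) (hs : HasCompactSupport ρ) (i : Fin n) :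
    coordDeriv i (w ⋆[ContinuousLinearMap.mul ℝ ℝ] ρ) =
      w ⋆[ContinuousLinearMap.mul ℝ ℝ] coordDeriv i ρ := by
  ext x
  rw [coordDeriv, (hs.hasFDerivAt_convolution_right _ hw.locallyIntegrable hρ x).fderiv,
    convolution_precompR_apply _ hw.locallyIntegrable (hs.fderiv ℝ)
      (hρ.continuous_fderiv one_ne_zero)]
  rfl

/-- Liouville's theorem for very weakly harmonic functions vanishing at infinity. -/
theorem nonpos_of_weakly_harmonic (hn : n ≠ 0) {w : EuclideanSpace ℝ (Fin n) → ℝ}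
    (hw : Continuous w) (hlim : Tendsto w (cocompact _) (𝓝 0))
    (hweak : ∀ φ : EuclideanSpace ℝ (Fin n) → ℝ, ContDiff ℝ (⊤ : ℕ∞) φ → HasCompactSupport φ →
      ∫ x, w x * (-laplacian φ x) = 0) (x₀ : EuclideanSpace ℝ (Fin n)) : w x₀ ≤ 0 := by
  have hmoll : ∀ B : ContDiffBump (0 : EuclideanSpace ℝ (Fin n)), B.rOut ≤ 1 →
      (B.normed volume ⋆[ContinuousLinearMap.lsmul ℝ ℝ] w) x₀ ≤ 0 := by
    intro B hB
    have hρ : ContDiff ℝ (⊤ : ℕ∞) (B.normed volume) := B.contDiff_normed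
    have hs : HasCompactSupport (B.normed volume) := B.hasCompactSupport_normed
    have hρ2 : ContDiff ℝ 2 (B.normed volume) := contDiff_infty.1 hρ 2
    have hρ1 : ∀ i, ContDiff ℝ 1 (coordDeriv i (B.normed volume)) := fun i =>
      ContDiff.coordDeriv (k := 1) hρ2 i
    have hflip : B.normed volume ⋆[ContinuousLinearMap.lsmul ℝ ℝ] w =
        w ⋆[ContinuousLinearMap.mul ℝ ℝ] B.normed volume := by
      rw [← convolution_flip]
      ext x
      simp only [convolution_def]
      congr 1
      ext t
      simp [mul_comm]
    refine nonpos_of_laplacian_nonneg hn ?_ ?_ (fun x => ?_) x₀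
    · rw [hflip]
      exact hs.contDiff_convolution_right (n := 2) _ hw.locallyIntegrable hρ2
    · rw [Metric.tendsto_nhds]
      intro ε hε
      have hev := Metric.tendsto_nhds.1 hlim (ε / 4) (by linarith)
      rw [← Metric.cobounded_eq_cocompact, ← comap_norm_atTop, eventually_comap] at hev ⊢
      obtain ⟨R, hR⟩ := eventually_atTop.1 hev
      have hR' : ∀ x, R ≤ ‖x‖ → dist (w x) 0 < ε / 4 := fun x hx => hR _ hx x rfl
      filter_upwards [eventually_ge_atTop (R + 1)] with r hr x hx
      have h1 := hR' x (by linarith)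
      have h2 := B.dist_normed_convolution_le (μ := volume) (x₀ := x) (ε := ε / 2)
        hw.aestronglyMeasurable (fun y hy => by
          have h3 : ‖x‖ ≤ ‖y‖ + 1 := by
            have h4 := norm_le_norm_add_norm_sub' x y
            rw [mem_ball_iff_norm'] at hy
            linarith
          have h5 := dist_triangle_right (w y) (w x) 0
          linarith [hR' y (by linarith)])
      linarith [dist_triangle ((B.normed volume ⋆[ContinuousLinearMap.lsmul ℝ ℝ] w) x) (w x) 0]
    · have hint : ∀ i, Integrable fun t =>
          w t * coordDeriv i (coordDeriv i (B.normed volume)) (x - t) := fun i => by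
        refine Continuous.integrable_of_hasCompactSupport
          (hw.mul ((ContDiff.coordDeriv (k := 0) (hρ1 i) i).continuous.comp
            (continuous_const.sub continuous_id))) (HasCompactSupport.mul_left ?_)
        exact ((hs.coordDeriv i).coordDeriv i).comp_homeomorph (Homeomorph.subLeft x)
      have hsx : HasCompactSupport fun t => B.normed volume (x - t) :=
        hs.comp_homeomorph (Homeomorph.subLeft x)
      have h := hweak (fun t => B.normed volume (x - t)) (hρ.comp (contDiff_const.sub contDiff_id))
        hsx
      simp only [laplacian_comp_const_sub hρ2, mul_neg, integral_neg, neg_eq_zero] at h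
      rw [hflip, laplacian_eq_sum_coordDeriv]
      simp only [coordDeriv_convolution hw (hρ2.of_le one_le_two) hs,
        coordDeriv_convolution hw (hρ1 _) (hs.coordDeriv _), convolution_def,
        ContinuousLinearMap.mul_apply']
      rw [← integral_finsetSum _ fun i _ => hint i]
      simp only [← Finset.mul_sum, ← laplacian_eq_sum_coordDeriv]
      exact h.ge
  let B : ℕ → ContDiffBump (0 : EuclideanSpace ℝ (Fin n)) := fun k =>
    ⟨1 / ((k : ℝ) + 1) / 2, 1 / ((k : ℝ) + 1), by positivity, half_lt_self (by positivity)⟩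
  refine le_of_tendsto (ContDiffBump.convolution_tendsto_right_of_continuous (μ := volume)
    (φ := B) tendsto_one_div_add_atTop_nhds_zero_nat hw x₀)
    (Eventually.of_forall fun k => hmoll (B k) ?_)
  exact (div_le_one (by positivity)).2 (by simp)

end uniqueness

end NewtonPotential

/-- Let `n > 2`, `α ∈ (0, n/2 − 1)`. For every continuous `f` with
`|f(x)| ≤ C(1+|x|²)^(−α−1)`, there is exactly one solution `u` of `−Δu = f`
(in the weak/distributional sense, as appropriate for strong solutions)
satisfying `|u(x)| ≤ C'(1+|x|²)^(−α)` for some constant `C'`. -/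
theorem exists_unique_decaying_solution (n : ℕ) (hn : 2 < n) (α : ℝ) (hα0 : 0 < α)
    (hα1 : α < (n : ℝ) / 2 - 1) (C : ℝ) (f : EuclideanSpace ℝ (Fin n) → ℝ)
    (hf : Continuous f) (hfb : ∀ x, |f x| ≤ C * (1 + ‖x‖ ^ 2) ^ (-α - 1)) :
    ∃! u : EuclideanSpace ℝ (Fin n) → ℝ,
      Continuous u ∧
      (∃ C' > 0, ∀ x, |u x| ≤ C' * (1 + ‖x‖ ^ 2) ^ (-α)) ∧
      (∀ φ : EuclideanSpace ℝ (Fin n) → ℝ, ContDiff ℝ (⊤ : ℕ∞) φ → HasCompactSupport φ →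
        ∫ x, u x * (-laplacian φ x) = ∫ x, f x * φ x) := by
  have hfb' : ∀ x, |f x| ≤ C * radialPow 1 (α + 1) x := fun x => by
    rw [radialPow, add_comm _ (1 : ℝ), neg_add']
    exact hfb x
  have hK := newtonMass_pos hn
  refine existsUnique_of_exists_of_unique ⟨fun x => (newtonMass n)⁻¹ *
    ∫ z, radialPow 0 ((n : ℝ) / 2 - 1) z * f (x + z), ?_, ?_, fun φ hφ hs => ?_⟩ ?_
  · exact (continuous_integral_newton_mul hn hα0 hα1 hf hfb').const_mul _
  · obtain ⟨B, hB0, hB⟩ := exists_abs_integral_newton_mul_le hn hα0 hα1 hfb'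
    refine ⟨(newtonMass n)⁻¹ * B, by positivity, fun x => ?_⟩
    rw [abs_mul, abs_of_pos (inv_pos.2 hK), mul_assoc, add_comm (1 : ℝ)]
    exact mul_le_mul_of_nonneg_left (hB x) (inv_pos.2 hK).le
  · have hφ2 : ContDiff ℝ 2 φ := contDiff_infty.1 hφ 2
    simp only [mul_assoc]
    rw [integral_const_mul, integral_potential_mul_neg_laplacian hn hα0 hα1 hf hfb' hφ2 hs,
      inv_mul_cancel_left₀ hK.ne']
  · have key : ∀ u v : EuclideanSpace ℝ (Fin n) → ℝ,
        (Continuous u ∧ (∃ C' > 0, ∀ x, |u x| ≤ C' * (1 + ‖x‖ ^ 2) ^ (-α)) ∧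
          ∀ φ : EuclideanSpace ℝ (Fin n) → ℝ, ContDiff ℝ (⊤ : ℕ∞) φ → HasCompactSupport φ →
            ∫ x, u x * (-laplacian φ x) = ∫ x, f x * φ x) →
        (Continuous v ∧ (∃ C' > 0, ∀ x, |v x| ≤ C' * (1 + ‖x‖ ^ 2) ^ (-α)) ∧
          ∀ φ : EuclideanSpace ℝ (Fin n) → ℝ, ContDiff ℝ (⊤ : ℕ∞) φ → HasCompactSupport φ →
            ∫ x, v x * (-laplacian φ x) = ∫ x, f x * φ x) → ∀ x, u x ≤ v x := by
      rintro u v ⟨huc, ⟨D, -, hu⟩, huw⟩ ⟨hvc, ⟨D', -, hv⟩, hvw⟩ x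
      refine sub_nonpos.1 (nonpos_of_weakly_harmonic (by omega) (huc.sub hvc)
        ((PowDecay.sub ⟨D, hu⟩ ⟨D', hv⟩).tendsto_cocompact hα0) (fun φ hφ hs => ?_) x)
      have hφd := DecaysC2.of_hasCompactSupport (contDiff_infty.1 hφ 2) hs 1
      have hψ : Continuous fun x => -laplacian φ x := hφd.continuous_laplacian.neg
      have hψs : HasCompactSupport fun x => -laplacian φ x := hs.laplacian.neg
      have hint : ∀ g : EuclideanSpace ℝ (Fin n) → ℝ, Continuous g →
          Integrable fun x => g x * (-laplacian φ x) := fun g hg =>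
        (hg.mul hψ).integrable_of_hasCompactSupport hψs.mul_left
      simp only [Pi.sub_apply, sub_mul]
      rw [integral_sub (hint u huc) (hint v hvc), huw φ hφ hs, hvw φ hφ hs, sub_self]
    intro u v hu hv
    ext x
    exact le_antisymm (key u v hu hv x) (key v u hv hu x)
end

section
/- Let n > 2 and α > 0. For every continuous f : ℝⁿ → ℝ with |f(x)| ≤ C(log(2+|x|²))^(−α−1), there exists exactly one bounded solution u : ℝⁿ → ℝ of −(1+|x|²)Δu = f on ℝⁿ satisfying |u(x)| ≤ C'(log(2+|x|²))^(−α). -/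
open Real MeasureTheory

lemma ContDiff.fderiv_apply_const {n : ℕ} {a : EuclideanSpace ℝ (Fin n) → ℝ}
    {k l : WithTop ℕ∞} (ha : ContDiff ℝ l a) (hkl : k + 1 ≤ l)
    (v : EuclideanSpace ℝ (Fin n)) : ContDiff ℝ k (fun y => fderiv ℝ a y v) :=
  (ha.fderiv_right hkl).clm_apply contDiff_const

lemma ContDiff.continuous_laplacian {n : ℕ} {a : EuclideanSpace ℝ (Fin n) → ℝ}
    (ha : ContDiff ℝ 2 a) : Continuous (laplacian a) := by
  unfold laplacian
  refine continuous_finsetSum _ fun i _ => ?_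
  exact ((ha.fderiv_apply_const (k := 1) (by norm_num) _).fderiv_apply_const
    (k := 0) (by norm_num) _).continuous

lemma hasCompactSupport_laplacian {n : ℕ} {a : EuclideanSpace ℝ (Fin n) → ℝ}
    (ha : HasCompactSupport a) : HasCompactSupport (laplacian a) := by
  have h : laplacian a = ∑ i, fun x => fderiv ℝ (fun y => fderiv ℝ a y
      (EuclideanSpace.single i 1)) x (EuclideanSpace.single i 1) := by
    ext x; simp [laplacian]
  rw [h]
  refine Finset.sum_induction _ HasCompactSupport (fun _ _ => HasCompactSupport.add)
    HasCompactSupport.zero fun i _ => ?_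
  exact (ha.fderiv_apply ℝ _).fderiv_apply ℝ _

/-- Green's identity without boundary terms. -/
lemma integral_mul_laplacian_comm {n : ℕ} {a b : EuclideanSpace ℝ (Fin n) → ℝ}
    (ha : ContDiff ℝ 2 a) (hb : ContDiff ℝ 2 b) (hbs : HasCompactSupport b) :
    ∫ x, a x * laplacian b x = ∫ x, laplacian a x * b x := by
  have key : ∀ (c d : EuclideanSpace ℝ (Fin n) → ℝ) (v : EuclideanSpace ℝ (Fin n)),
      ContDiff ℝ 1 c → ContDiff ℝ 1 d → HasCompactSupport d →
      ∫ x, c x * fderiv ℝ d x v = - ∫ x, fderiv ℝ c x v * d x := by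
    intro c d v hc hd hds
    have hc' := (hc.fderiv_apply_const (k := 0) (by norm_num) v).continuous
    have hd' := (hd.fderiv_apply_const (k := 0) (by norm_num) v).continuous
    refine integral_mul_fderiv_eq_neg_fderiv_mul_of_integrable ?_ ?_ ?_ ?_ ?_
    · exact (hc'.mul hd.continuous).integrable_of_hasCompactSupport hds.mul_left
    · exact (hc.continuous.mul hd').integrable_of_hasCompactSupport
        (hds.fderiv_apply ℝ v).mul_left
    · exact (hc.continuous.mul hd.continuous).integrable_of_hasCompactSupport hds.mul_left
    · exact fun x _ => (hc.differentiable (by norm_num)) x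
    · exact fun x _ => (hd.differentiable (by norm_num)) x
  simp only [laplacian, Finset.mul_sum, Finset.sum_mul]
  rw [integral_finsetSum, integral_finsetSum]
  · refine Finset.sum_congr rfl fun i _ => ?_
    have ha1 := ha.fderiv_apply_const (k := 1) (by norm_num) (EuclideanSpace.single i (1 : ℝ))
    have hb1 := hb.fderiv_apply_const (k := 1) (by norm_num) (EuclideanSpace.single i (1 : ℝ))
    rw [key a _ _ (ha.of_le (by norm_num)) hb1 (hbs.fderiv_apply ℝ _),
      key _ b _ ha1 (hb.of_le (by norm_num)) hbs, neg_neg]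
  · intro i _
    have ha1 := ha.fderiv_apply_const (k := 1) (by norm_num) (EuclideanSpace.single i (1 : ℝ))
    exact ((ha1.fderiv_apply_const (k := 0) (by norm_num) _).continuous.mul
      hb.continuous).integrable_of_hasCompactSupport hbs.mul_left
  · intro i _
    have hb1 := hb.fderiv_apply_const (k := 1) (by norm_num) (EuclideanSpace.single i (1 : ℝ))
    exact (ha.continuous.mul (hb1.fderiv_apply_const (k := 0)
      (by norm_num) _).continuous).integrable_of_hasCompactSupport
      ((hbs.fderiv_apply ℝ _).fderiv_apply ℝ _).mul_left

/-- The Laplacian of a radial function written in terms of the squared radius. -/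
lemma laplacian_comp_norm_sub_sq {n : ℕ} {F F' F'' : ℝ → ℝ}
    (hF : ∀ s, 0 ≤ s → HasDerivAt F (F' s) s) (hF' : ∀ s, 0 ≤ s → HasDerivAt F' (F'' s) s)
    (x y : EuclideanSpace ℝ (Fin n)) :
    laplacian (fun y => F (‖y - x‖ ^ 2)) y
      = 4 * ‖y - x‖ ^ 2 * F'' (‖y - x‖ ^ 2) + 2 * n * F' (‖y - x‖ ^ 2) := by
  have hN : ∀ z, HasFDerivAt (fun z : EuclideanSpace ℝ (Fin n) => ‖z - x‖ ^ 2)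
      (2 • innerSL ℝ (z - x)) z := by
    intro z
    simpa using ((hasFDerivAt_id z).sub_const x).norm_sq
  have h1 : ∀ i, (fun z => fderiv ℝ (fun y => F (‖y - x‖ ^ 2)) z (EuclideanSpace.single i 1))
      = fun z => F' (‖z - x‖ ^ 2) * (2 * (z i - x i)) := by
    intro i
    ext z
    have h := ((hF _ (sq_nonneg _)).comp_hasFDerivAt z (hN z)).fderiv
    simp only [Function.comp_def] at h
    refine (congrArg (fun L => L (EuclideanSpace.single i 1)) h).trans ?_
    simp [EuclideanSpace.inner_single_right]
  have h2 : ∀ i, fderiv ℝ (fun z : EuclideanSpace ℝ (Fin n) =>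
      F' (‖z - x‖ ^ 2) * (2 * (z i - x i))) y (EuclideanSpace.single i 1)
      = 4 * F'' (‖y - x‖ ^ 2) * (y i - x i) ^ 2 + 2 * F' (‖y - x‖ ^ 2) := by
    intro i
    have hp : HasFDerivAt (fun z : EuclideanSpace ℝ (Fin n) => 2 * (z i - x i))
        ((2 : ℝ) • EuclideanSpace.proj (𝕜 := ℝ) i) y :=
      (((EuclideanSpace.proj (𝕜 := ℝ) i).hasFDerivAt).sub_const (x i)).const_mul 2
    have := ((hF' _ (sq_nonneg _)).comp_hasFDerivAt y (hN y)).mul hp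
    have h := this.fderiv
    simp only [Function.comp_def] at h
    refine (congrArg (fun L => L (EuclideanSpace.single i 1)) h).trans ?_
    simp [EuclideanSpace.inner_single_right]
    ring
  simp only [laplacian, h1, h2, Finset.sum_add_distrib, ← Finset.mul_sum]
  rw [EuclideanSpace.real_norm_sq_eq (y - x)]
  simp
  ring

/-- The smooth convex function vanishing on `(-∞, 0]` whose derivative is
`Real.smoothTransition`. -/
noncomputable def convexRamp (t : ℝ) : ℝ := ∫ s in (0 : ℝ)..t, smoothTransition s

lemma hasDerivAt_convexRamp (t : ℝ) : HasDerivAt convexRamp (smoothTransition t) t :=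
  intervalIntegral.integral_hasDerivAt_right
    (smoothTransition.continuous.intervalIntegrable _ _)
    (smoothTransition.continuous.stronglyMeasurableAtFilter _ _)
    smoothTransition.continuous.continuousAt

lemma contDiff_convexRamp : ContDiff ℝ (⊤ : ℕ∞) convexRamp := by
  rw [contDiff_infty_iff_deriv]
  refine ⟨fun t => (hasDerivAt_convexRamp t).differentiableAt, ?_⟩
  rw [show deriv convexRamp = smoothTransition from
    funext fun t => (hasDerivAt_convexRamp t).deriv]
  exact smoothTransition.contDiff

lemma convexRamp_of_nonpos {t : ℝ} (ht : t ≤ 0) : convexRamp t = 0 := by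
  rw [convexRamp, intervalIntegral.integral_congr (g := fun _ => 0)]
  · simp
  · intro s hs
    rw [Set.uIcc_of_ge ht] at hs
    exact smoothTransition.zero_of_nonpos hs.2

lemma monotone_convexRamp : Monotone convexRamp :=
  monotone_of_hasDerivAt_nonneg hasDerivAt_convexRamp fun t => smoothTransition.nonneg t

lemma convexRamp_nonneg (t : ℝ) : 0 ≤ convexRamp t := by
  rcases le_total t 0 with h | h
  · exact (convexRamp_of_nonpos h).ge
  · exact (convexRamp_of_nonpos le_rfl).ge.trans (monotone_convexRamp h)

lemma convexRamp_le {t : ℝ} (ht : 0 ≤ t) : convexRamp t ≤ t := by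
  have h : Monotone fun t => t - convexRamp t :=
    monotone_of_hasDerivAt_nonneg (fun t => (hasDerivAt_id t).sub (hasDerivAt_convexRamp t))
      fun t => sub_nonneg.2 (smoothTransition.le_one t)
  have := h ht
  simp only [convexRamp_of_nonpos le_rfl] at this
  linarith

lemma sub_one_le_convexRamp (t : ℝ) : t - 1 ≤ convexRamp t := by
  rcases le_total t 1 with h | h
  · linarith [convexRamp_nonneg t]
  · have hd : ∀ s, HasDerivAt (fun t => convexRamp t - t) (smoothTransition s - 1) s :=
      fun s => (hasDerivAt_convexRamp s).sub (hasDerivAt_id s)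
    have := monotoneOn_of_deriv_nonneg (convex_Ici (1 : ℝ))
      (fun s _ => (hd s).continuousAt.continuousWithinAt)
      (fun s _ => (hd s).differentiableAt.differentiableWithinAt)
      (fun s hs => by
        rw [interior_Ici] at hs
        rw [(hd s).deriv, smoothTransition.one_of_one_le (le_of_lt hs), sub_self])
      Set.self_mem_Ici (Set.mem_Ici.2 h) h
    simp only at this
    linarith [convexRamp_nonneg 1]

lemma deriv_smoothTransition_of_one_lt {t : ℝ} (ht : 1 < t) : deriv smoothTransition t = 0 := by
  have h : smoothTransition =ᶠ[nhds t] fun _ => 1 := by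
    filter_upwards [lt_mem_nhds ht] with s hs using smoothTransition.one_of_one_le hs.le
  rw [h.deriv_eq, deriv_const]

lemma hasDerivAt_add_rpow_neg {c : ℝ} (hc : 0 < c) (p : ℝ) {s : ℝ} (hs : 0 ≤ s) :
    HasDerivAt (fun s : ℝ => (s + c) ^ (-p)) (-p * (s + c) ^ (-p - 1)) s := by
  simpa using ((hasDerivAt_id s).add_const c).rpow_const (p := -p)
    (Or.inl (by simp; positivity))

/-- The regularised Newtonian kernel in dimension `2 * m + 2`, as a function of the squared
radius and up to a constant factor. -/
noncomputable def regKernel (m ε s : ℝ) : ℝ := (s + ε ^ 2) ^ (-m)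

/-- Minus the Laplacian of `regKernel`. -/
noncomputable def regDensity (m ε s : ℝ) : ℝ :=
  4 * m * (m + 1) * ε ^ 2 * (s + ε ^ 2) ^ (-m - 2)

lemma regDensity_nonneg {m ε s : ℝ} (hm : 0 < m) (hs : 0 ≤ s) : 0 ≤ regDensity m ε s := by
  unfold regDensity; positivity

lemma contDiff_regKernel {n : ℕ} {m ε : ℝ} (hε : 0 < ε) (x : EuclideanSpace ℝ (Fin n)) :
    ContDiff ℝ (⊤ : ℕ∞) fun y : EuclideanSpace ℝ (Fin n) => regKernel m ε (‖y - x‖ ^ 2) := by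
  unfold regKernel
  refine ContDiff.rpow_const_of_ne ?_ fun y => ?_
  · exact ((contDiff_id.sub contDiff_const).norm_sq ℝ).add contDiff_const
  · positivity

lemma laplacian_regKernel {n : ℕ} {m ε : ℝ} (hn : (n : ℝ) = 2 * m + 2) (hε : 0 < ε)
    (x y : EuclideanSpace ℝ (Fin n)) :
    laplacian (fun y => regKernel m ε (‖y - x‖ ^ 2)) y = - regDensity m ε (‖y - x‖ ^ 2) := by
  have hc : 0 < ε ^ 2 := by positivity
  rw [laplacian_comp_norm_sub_sq (F := regKernel m ε)
    (fun s hs => hasDerivAt_add_rpow_neg hc m hs) (fun s hs => by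
      simpa [sub_eq_add_neg, add_comm] using
        (hasDerivAt_add_rpow_neg hc (m + 1) hs).const_mul (-m)), hn, regDensity]
  set s := ‖y - x‖ ^ 2 with hs
  have h0 : 0 < s + ε ^ 2 := by positivity
  have e1 : (s + ε ^ 2) ^ (-m - 1) = (s + ε ^ 2) ^ (-m - 2) * (s + ε ^ 2) := by
    rw [← rpow_add_one h0.ne']; ring_nf
  ring_nf at e1 ⊢
  rw [e1]
  ring

lemma laplacian_convexRamp_regKernel {n : ℕ} {m ε : ℝ} (hn : (n : ℝ) = 2 * m + 2) (hε : 0 < ε)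
    (x y : EuclideanSpace ℝ (Fin n)) :
    laplacian (fun y => ε * convexRamp (regKernel m ε (‖y - x‖ ^ 2) / ε - 1)) y
      = - smoothTransition (regKernel m ε (‖y - x‖ ^ 2) / ε - 1) * regDensity m ε (‖y - x‖ ^ 2)
        + 4 * ‖y - x‖ ^ 2 * (m * (‖y - x‖ ^ 2 + ε ^ 2) ^ (-m - 1)) ^ 2 / ε
          * deriv smoothTransition (regKernel m ε (‖y - x‖ ^ 2) / ε - 1) := by
  have hc : 0 < ε ^ 2 := by positivity
  have hQ : ∀ s, 0 ≤ s → HasDerivAt (regKernel m ε) (-m * (s + ε ^ 2) ^ (-m - 1)) s :=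
    fun s hs => hasDerivAt_add_rpow_neg hc m hs
  have hQ' : ∀ s, 0 ≤ s → HasDerivAt (fun s => -m * (s + ε ^ 2) ^ (-m - 1))
      (-m * ((-m - 1) * (s + ε ^ 2) ^ (-m - 2))) s := by
    intro s hs
    rw [show -m - 2 = -(m + 1) - 1 by ring, show -m - 1 = -(m + 1) by ring]
    exact (hasDerivAt_add_rpow_neg hc (m + 1) hs).const_mul (-m)
  have hst : Differentiable ℝ smoothTransition :=
    (smoothTransition.contDiff (n := 1)).differentiable (by norm_num)
  rw [laplacian_comp_norm_sub_sq (F := fun s => ε * convexRamp (regKernel m ε s / ε - 1))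
    (F' := fun s => smoothTransition (regKernel m ε s / ε - 1) * (-m * (s + ε ^ 2) ^ (-m - 1)))
    (fun s hs => by
      refine (((hasDerivAt_convexRamp (regKernel m ε s / ε - 1)).comp s
        (((hQ s hs).div_const ε).sub_const 1)).const_mul ε).congr_deriv ?_
      field_simp)
    (fun s hs => ((hst (regKernel m ε s / ε - 1)).hasDerivAt.comp s
      (((hQ s hs).div_const ε).sub_const 1)).mul (hQ' s hs)), hn, regDensity]
  simp only [Function.comp_apply]
  set s := ‖y - x‖ ^ 2 with hs
  have h0 : 0 < s + ε ^ 2 := by positivity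
  have e1 : (s + ε ^ 2) ^ (-m - 1) = (s + ε ^ 2) ^ (-m - 2) * (s + ε ^ 2) := by
    rw [← rpow_add_one h0.ne']; ring_nf
  rw [e1]
  field_simp
  ring

/-- Smooth compactly supported subsolutions approximating the Newtonian kernel from below. -/
lemma exists_truncated_kernel {n : ℕ} {m ε : ℝ} (hm : 0 < m) (hn : (n : ℝ) = 2 * m + 2)
    (hε : 0 < ε) (x : EuclideanSpace ℝ (Fin n)) :
    ∃ φ : EuclideanSpace ℝ (Fin n) → ℝ, ContDiff ℝ (⊤ : ℕ∞) φ ∧ HasCompactSupport φ ∧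
      (∀ y, 0 ≤ φ y) ∧
      (∀ y, regKernel m ε (‖y - x‖ ^ 2) - 2 * ε ≤ φ y) ∧
      (∀ y, φ y ≤ regKernel m ε (‖y - x‖ ^ 2)) ∧
      (∀ y, 0 ≤ regDensity m ε (‖y - x‖ ^ 2) + laplacian φ y) ∧
      (∀ y, 2 * ε < regKernel m ε (‖y - x‖ ^ 2) →
        regDensity m ε (‖y - x‖ ^ 2) + laplacian φ y = 0) := by
  have hQ0 : ∀ y, 0 ≤ regKernel m ε (‖y - x‖ ^ 2) := fun y => by unfold regKernel; positivity
  refine ⟨fun y => ε * convexRamp (regKernel m ε (‖y - x‖ ^ 2) / ε - 1), ?_, ?_, ?_, ?_, ?_, ?_,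
    ?_⟩
  · exact contDiff_const.mul (contDiff_convexRamp.comp
      (((contDiff_regKernel hε x).div_const ε).sub contDiff_const))
  · have ht : Filter.Tendsto (regKernel m ε) Filter.atTop (nhds 0) :=
      (tendsto_rpow_neg_atTop hm).comp (Filter.tendsto_atTop_add_const_right _ _ Filter.tendsto_id)
    obtain ⟨S, hS⟩ := Filter.eventually_atTop.1 (ht.eventually_le_const hε)
    refine HasCompactSupport.intro (isCompact_closedBall x (|S| + 1)) fun y hy => ?_
    rw [mem_closedBall_iff_norm, not_le] at hy
    have h1 : S ≤ ‖y - x‖ ^ 2 := by nlinarith [le_abs_self S, abs_nonneg S]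
    rw [convexRamp_of_nonpos, mul_zero]
    rw [sub_nonpos, div_le_one hε]
    exact hS _ h1
  · exact fun y => mul_nonneg hε.le (convexRamp_nonneg _)
  · intro y
    have := mul_le_mul_of_nonneg_left
      (sub_one_le_convexRamp (regKernel m ε (‖y - x‖ ^ 2) / ε - 1)) hε.le
    refine le_trans (le_of_eq ?_) this
    field_simp
    ring
  · intro y
    have h1 : 0 ≤ regKernel m ε (‖y - x‖ ^ 2) / ε := div_nonneg (hQ0 y) hε.le
    have := mul_le_mul_of_nonneg_left
      ((monotone_convexRamp (sub_le_self _ zero_le_one)).trans (convexRamp_le h1)) hε.le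
    rwa [mul_div_cancel₀ _ hε.ne'] at this
  · intro y
    rw [laplacian_convexRamp_regKernel hn hε]
    have h1 := smoothTransition.le_one (regKernel m ε (‖y - x‖ ^ 2) / ε - 1)
    have h2 : 0 ≤ deriv smoothTransition (regKernel m ε (‖y - x‖ ^ 2) / ε - 1) :=
      smoothTransition.monotone.deriv_nonneg
    have h3 := mul_nonneg (sub_nonneg.2 h1)
      (regDensity_nonneg (ε := ε) hm (sq_nonneg ‖y - x‖))
    have h4 : 0 ≤ 4 * ‖y - x‖ ^ 2 * (m * (‖y - x‖ ^ 2 + ε ^ 2) ^ (-m - 1)) ^ 2 / ε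
          * deriv smoothTransition (regKernel m ε (‖y - x‖ ^ 2) / ε - 1) := by positivity
    linarith
  · intro y hy
    have h1 : 1 < regKernel m ε (‖y - x‖ ^ 2) / ε - 1 := by
      rw [lt_sub_iff_add_lt, lt_div_iff₀ hε]; linarith
    rw [laplacian_convexRamp_regKernel hn hε, deriv_smoothTransition_of_one_lt h1,
      smoothTransition.one_of_one_le h1.le]
    ring

/-- The total mass of `regDensity`. -/
noncomputable def kernelMass (n : ℕ) (m : ℝ) : ℝ :=
  ∫ z : EuclideanSpace ℝ (Fin n), regDensity m 1 (‖z‖ ^ 2)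

lemma integrable_regDensity_one {n : ℕ} {m : ℝ} (hn : (n : ℝ) = 2 * m + 2) :
    Integrable fun z : EuclideanSpace ℝ (Fin n) => regDensity m 1 (‖z‖ ^ 2) := by
  have h := integrable_rpow_neg_one_add_norm_sq (E := EuclideanSpace ℝ (Fin n)) (μ := volume)
    (r := 2 * m + 4) (by rw [finrank_euclideanSpace_fin, hn]; linarith)
  refine (h.const_mul (4 * m * (m + 1))).congr (Filter.Eventually.of_forall fun z => ?_)
  simp only [regDensity]
  rw [show -(2 * m + 4) / 2 = -m - 2 by ring]
  simp [add_comm]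

lemma kernelMass_pos {n : ℕ} {m : ℝ} (hm : 0 < m) (hn : (n : ℝ) = 2 * m + 2) :
    0 < kernelMass n m := by
  have hpos : ∀ z : EuclideanSpace ℝ (Fin n), 0 < regDensity m 1 (‖z‖ ^ 2) := fun z => by
    unfold regDensity; positivity
  rw [kernelMass, integral_pos_iff_support_of_nonneg (fun z => (hpos z).le)
    (integrable_regDensity_one hn)]
  rw [show Function.support (fun z : EuclideanSpace ℝ (Fin n) => regDensity m 1 (‖z‖ ^ 2))
    = Set.univ from Set.eq_univ_of_forall fun z => (hpos z).ne']
  exact isOpen_univ.measure_pos _ Set.univ_nonempty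

lemma integral_mul_regDensity {n : ℕ} {m ε : ℝ} (hn : (n : ℝ) = 2 * m + 2) (hε : 0 < ε)
    (F : EuclideanSpace ℝ (Fin n) → ℝ) (x : EuclideanSpace ℝ (Fin n)) :
    ∫ y, F y * regDensity m ε (‖y - x‖ ^ 2)
      = ∫ z, F (x + ε • z) * regDensity m 1 (‖z‖ ^ 2) := by
  have hs : ∀ z : EuclideanSpace ℝ (Fin n), F (x + ε • z) * regDensity m 1 (‖z‖ ^ 2)
      = ε ^ n * (F (x + ε • z) * regDensity m ε (‖x + ε • z - x‖ ^ 2)) := by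
    intro z
    have h1 : ‖x + ε • z - x‖ ^ 2 + ε ^ 2 = ε ^ 2 * (‖z‖ ^ 2 + 1 ^ 2) := by
      rw [add_sub_cancel_left, norm_smul, Real.norm_eq_abs, abs_of_pos hε]; ring
    have h2 : ε ^ n * ε ^ 2 * (ε ^ 2) ^ (-m - 2) = 1 := by
      rw [← Real.rpow_natCast ε n, ← Real.rpow_natCast ε 2, ← Real.rpow_mul hε.le,
        ← Real.rpow_add hε, ← Real.rpow_add hε, hn]
      convert Real.rpow_zero ε using 2
      push_cast
      ring
    simp only [regDensity, h1]
    rw [Real.mul_rpow (by positivity) (by positivity)]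
    linear_combination (-F (x + ε • z) * (4 * m * (m + 1) * (‖z‖ ^ 2 + 1 ^ 2) ^ (-m - 2))) * h2
  simp_rw [hs]
  rw [integral_const_mul, Measure.integral_comp_smul volume
    (fun v => F (x + v) * regDensity m ε (‖x + v - x‖ ^ 2)),
    integral_add_left_eq_self (fun v => F v * regDensity m ε (‖v - x‖ ^ 2)),
    finrank_euclideanSpace_fin, abs_of_pos (by positivity), smul_eq_mul,
    mul_inv_cancel_left₀ (by positivity)]

lemma integral_regDensity {n : ℕ} {m ε : ℝ} (hn : (n : ℝ) = 2 * m + 2) (hε : 0 < ε)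
    (x : EuclideanSpace ℝ (Fin n)) :
    ∫ y, regDensity m ε (‖y - x‖ ^ 2) = kernelMass n m := by
  simpa [kernelMass] using integral_mul_regDensity hn hε (fun _ => 1) x

lemma integrable_regDensity {n : ℕ} {m ε : ℝ} (hm : 0 < m) (hn : (n : ℝ) = 2 * m + 2)
    (hε : 0 < ε) (x : EuclideanSpace ℝ (Fin n)) :
    Integrable fun y : EuclideanSpace ℝ (Fin n) => regDensity m ε (‖y - x‖ ^ 2) := by
  by_contra h
  have := integral_regDensity hn hε x
  rw [integral_undef h] at this
  exact (kernelMass_pos hm hn).ne this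

lemma integrable_mul_regDensity {n : ℕ} {m ε : ℝ} (hm : 0 < m) (hn : (n : ℝ) = 2 * m + 2)
    (hε : 0 < ε) (x : EuclideanSpace ℝ (Fin n)) {F : EuclideanSpace ℝ (Fin n) → ℝ}
    (hF : Continuous F) {M : ℝ} (hM : ∀ y, |F y| ≤ M) :
    Integrable fun y => F y * regDensity m ε (‖y - x‖ ^ 2) :=
  (integrable_regDensity hm hn hε x).bdd_mul hF.aestronglyMeasurable
    (Filter.Eventually.of_forall hM)

lemma tendsto_integral_mul_regDensity {n : ℕ} {m : ℝ} (hm : 0 < m) (hn : (n : ℝ) = 2 * m + 2)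
    {F : EuclideanSpace ℝ (Fin n) → ℝ} (hF : Continuous F) {M : ℝ} (hM : ∀ y, |F y| ≤ M)
    (x : EuclideanSpace ℝ (Fin n)) :
    Filter.Tendsto (fun ε => ∫ y, F y * regDensity m ε (‖y - x‖ ^ 2)) (nhdsWithin 0 (Set.Ioi 0))
      (nhds (F x * kernelMass n m)) := by
  have h : Filter.Tendsto (fun ε : ℝ => ∫ z, F (x + ε • z) * regDensity m 1 (‖z‖ ^ 2))
      (nhdsWithin 0 (Set.Ioi 0)) (nhds (∫ z : EuclideanSpace ℝ (Fin n), F x * regDensity m 1 (‖z‖ ^ 2))) := by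
    refine tendsto_integral_filter_of_dominated_convergence
      (fun z : EuclideanSpace ℝ (Fin n) => M * regDensity m 1 (‖z‖ ^ 2)) ?_ ?_ ((integrable_regDensity_one hn).const_mul M) ?_
    · refine Filter.Eventually.of_forall fun ε => ?_
      exact (Continuous.aestronglyMeasurable (by fun_prop)).mul
        (integrable_regDensity_one hn).aestronglyMeasurable
    · refine Filter.Eventually.of_forall fun ε => Filter.Eventually.of_forall fun z => ?_
      have h0 := regDensity_nonneg (ε := 1) hm (sq_nonneg ‖z‖)
      rw [Real.norm_eq_abs, abs_mul, abs_of_nonneg h0]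
      exact mul_le_mul_of_nonneg_right (hM _) h0
    · refine Filter.Eventually.of_forall fun z => Filter.Tendsto.mul_const _ ?_
      have hc : Continuous fun ε : ℝ => F (x + ε • z) := by fun_prop
      simpa using (hc.tendsto 0).mono_left nhdsWithin_le_nhds
  rw [integral_const_mul] at h
  refine h.congr' ?_
  filter_upwards [self_mem_nhdsWithin] with ε hε
  exact (integral_mul_regDensity hn hε F x).symm

/-- Liouville's theorem for continuous weakly harmonic functions vanishing at infinity. -/
lemma eq_zero_of_weakly_harmonic {n : ℕ} {m : ℝ} (hm : 0 < m) (hn : (n : ℝ) = 2 * m + 2)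
    {w : EuclideanSpace ℝ (Fin n) → ℝ} (hw : Continuous w) {M : ℝ} (hM : ∀ y, |w y| ≤ M)
    (hw0 : ∀ η > 0, ∃ ρ : ℝ, ∀ y, ρ ≤ ‖y‖ → |w y| ≤ η)
    (hharm : ∀ φ : EuclideanSpace ℝ (Fin n) → ℝ, ContDiff ℝ (⊤ : ℕ∞) φ → HasCompactSupport φ →
      ∫ x, w x * laplacian φ x = 0) (x : EuclideanSpace ℝ (Fin n)) : w x = 0 := by
  have hκ := kernelMass_pos hm hn
  suffices h : ∀ η > 0, |w x| ≤ η by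
    exact abs_eq_zero.1 (le_antisymm (le_of_forall_gt_imp_ge_of_dense h) (abs_nonneg _))
  intro η hη
  obtain ⟨ρ, hρ⟩ := hw0 η hη
  set R := |ρ| + ‖x‖ + 1 with hR
  have hR0 : 0 < R := by positivity
  have hev : ∀ᶠ ε in nhdsWithin (0 : ℝ) (Set.Ioi 0), 2 * ε < regKernel m ε (R ^ 2) := by
    have hc : ContinuousAt (fun ε => regKernel m ε (R ^ 2) - 2 * ε) 0 := by
      unfold regKernel
      refine ContinuousAt.sub (ContinuousAt.rpow_const (by fun_prop) (Or.inl ?_)) (by fun_prop)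
      positivity
    have h0 : 0 < regKernel m 0 (R ^ 2) - 2 * 0 := by
      unfold regKernel
      rw [mul_zero, sub_zero]
      positivity
    filter_upwards [nhdsWithin_le_nhds (hc.eventually (lt_mem_nhds h0))] with ε hε
    linarith
  refine le_of_mul_le_mul_right ?_ hκ
  rw [← abs_of_pos hκ, ← abs_mul, abs_of_pos hκ]
  refine le_of_tendsto (tendsto_integral_mul_regDensity hm hn hw hM x).abs ?_
  filter_upwards [hev, self_mem_nhdsWithin] with ε hε hε0
  obtain ⟨φ, hφ, hφs, -, -, -, hB0, hB⟩ := exists_truncated_kernel hm hn hε0 x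
  have hφ2 : ContDiff ℝ 2 φ := contDiff_infty.1 hφ 2
  have hΔ := hφ2.continuous_laplacian
  have hΔi : Integrable (laplacian φ) :=
    hΔ.integrable_of_hasCompactSupport (hasCompactSupport_laplacian hφs)
  have hwΔi : Integrable fun y => w y * laplacian φ y :=
    (hw.mul hΔ).integrable_of_hasCompactSupport (hasCompactSupport_laplacian hφs).mul_left
  have hΔ0 : ∫ y, laplacian φ y = 0 := by
    have := integral_mul_laplacian_comm (contDiff_const (c := (1 : ℝ))) hφ2 hφs
    simpa [laplacian] using this
  have hψi := integrable_regDensity hm hn hε0 x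
  have h1 : ∫ y, w y * regDensity m ε (‖y - x‖ ^ 2)
      = ∫ y, w y * (regDensity m ε (‖y - x‖ ^ 2) + laplacian φ y) := by
    simp_rw [mul_add]
    rw [integral_add (integrable_mul_regDensity hm hn hε0 x hw hM) hwΔi, hharm φ hφ hφs, add_zero]
  have h2 : ∫ y, η * (regDensity m ε (‖y - x‖ ^ 2) + laplacian φ y) = η * kernelMass n m := by
    rw [integral_const_mul, integral_add hψi hΔi, hΔ0, add_zero, integral_regDensity hn hε0]
  rw [h1, ← h2, ← Real.norm_eq_abs]
  refine norm_integral_le_of_norm_le ((hψi.add hΔi).const_mul η)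
    (Filter.Eventually.of_forall fun y => ?_)
  rw [Real.norm_eq_abs, abs_mul, abs_of_nonneg (hB0 y)]
  by_cases hy : ‖y - x‖ < R
  · rw [hB y (hε.trans_le ?_)]
    · simp
    · have h0 : 0 < ε := hε0
      exact Real.rpow_le_rpow_of_nonpos (by positivity)
        (by gcongr) (by linarith)
  · refine mul_le_mul_of_nonneg_right (hρ y ?_) (hB0 y)
    have := norm_sub_le y x
    linarith [le_abs_self ρ]

lemma tendsto_regKernel {m s : ℝ} (hs : 0 < s) :
    Filter.Tendsto (fun ε => regKernel m ε s) (nhdsWithin 0 (Set.Ioi 0)) (nhds (s ^ (-m))) := by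
  have hc : ContinuousAt (fun ε => regKernel m ε s) 0 := by
    unfold regKernel
    exact ContinuousAt.rpow_const (by fun_prop) (Or.inl (by positivity))
  have h := hc.tendsto
  rw [show regKernel m 0 s = s ^ (-m) by simp [regKernel]] at h
  exact h.mono_left nhdsWithin_le_nhds

/-- The Newtonian potential of `-ΔW` is controlled by a nonnegative bounded supersolution `W`. -/
lemma integrable_and_integral_potential_le {n : ℕ} {m : ℝ} (hm : 0 < m)
    (hn : (n : ℝ) = 2 * m + 2) {W : EuclideanSpace ℝ (Fin n) → ℝ} (hW : ContDiff ℝ 2 W)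
    (hW0 : ∀ y, 0 ≤ W y) {M : ℝ} (hM : ∀ y, W y ≤ M) (hH : ∀ y, laplacian W y ≤ 0)
    (x : EuclideanSpace ℝ (Fin n)) :
    Integrable (fun y => (‖y - x‖ ^ 2) ^ (-m) * -laplacian W y) ∧
      ∫ y, (‖y - x‖ ^ 2) ^ (-m) * -laplacian W y ≤ W x * kernelMass n m := by
  have hM' : ∀ y, |W y| ≤ M := fun y => by rw [abs_of_nonneg (hW0 y)]; exact hM y
  have hΔ := hW.continuous_laplacian
  set δ : ℕ → ℝ := fun k => 1 / ((k : ℝ) + 1) with hδ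
  have hδ0 : ∀ k, 0 < δ k := fun k => by positivity
  have hδt : Filter.Tendsto δ Filter.atTop (nhdsWithin 0 (Set.Ioi 0)) :=
    tendsto_nhdsWithin_iff.2 ⟨tendsto_one_div_add_atTop_nhds_zero_nat,
      Filter.Eventually.of_forall hδ0⟩
  choose φ hφ hφs hφ0 hφl hφu hB _ using fun k => exists_truncated_kernel hm hn (hδ0 k) x
  have hφ2 : ∀ k, ContDiff ℝ 2 (φ k) := fun k => contDiff_infty.1 (hφ k) 2
  have hle : ∀ k, ∫ y, φ k y * -laplacian W y
      ≤ ∫ y, W y * regDensity m (δ k) (‖y - x‖ ^ 2) := by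
    intro k
    have h1 : ∫ y, φ k y * -laplacian W y = ∫ y, W y * -laplacian (φ k) y := by
      simp_rw [mul_neg]
      rw [integral_neg, integral_neg, integral_mul_laplacian_comm hW (hφ2 k) (hφs k)]
      simp_rw [mul_comm]
    rw [h1]
    refine integral_mono ?_ (integrable_mul_regDensity hm hn (hδ0 k) x hW.continuous hM')
      fun y => mul_le_mul_of_nonneg_left (by linarith [hB k y]) (hW0 y)
    exact (hW.continuous.mul (hφ2 k).continuous_laplacian.neg).integrable_of_hasCompactSupport
      (hasCompactSupport_laplacian (hφs k)).neg.mul_left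
  have hnn : ∀ y, 0 ≤ (‖y - x‖ ^ 2) ^ (-m) * -laplacian W y := fun y =>
    mul_nonneg (by positivity) (neg_nonneg.2 (hH y))
  have hmeas : Measurable fun y => (‖y - x‖ ^ 2) ^ (-m) * -laplacian W y :=
    Measurable.mul (by fun_prop) hΔ.measurable.neg
  have hlim : ∀ y, ENNReal.ofReal ((‖y - x‖ ^ 2) ^ (-m) * -laplacian W y)
      ≤ Filter.liminf (fun k => ENNReal.ofReal (φ k y * -laplacian W y)) Filter.atTop := by
    intro y
    by_cases hy : y = x
    · subst hy
      simp [Real.zero_rpow (neg_ne_zero.2 hm.ne')]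
    · have hs : 0 < ‖y - x‖ ^ 2 := by
        have := norm_pos_iff.2 (sub_ne_zero.2 hy)
        positivity
      have hQ := (tendsto_regKernel (m := m) hs).comp hδt
      have hQ' := hQ.sub ((hδt.mono_right nhdsWithin_le_nhds).const_mul 2)
      rw [mul_zero, sub_zero] at hQ'
      have ht : Filter.Tendsto (fun k => φ k y) Filter.atTop (nhds ((‖y - x‖ ^ 2) ^ (-m))) :=
        tendsto_of_tendsto_of_tendsto_of_le_of_le hQ' hQ (fun k => hφl k y) (fun k => hφu k y)
      exact (ENNReal.tendsto_ofReal (ht.mul_const _)).liminf_eq.ge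
  have hkey : ∫⁻ y, ENNReal.ofReal ((‖y - x‖ ^ 2) ^ (-m) * -laplacian W y)
      ≤ ENNReal.ofReal (W x * kernelMass n m) := by
    calc _ ≤ ∫⁻ y, Filter.liminf (fun k => ENNReal.ofReal (φ k y * -laplacian W y)) Filter.atTop :=
          lintegral_mono hlim
      _ ≤ Filter.liminf (fun k => ∫⁻ y, ENNReal.ofReal (φ k y * -laplacian W y)) Filter.atTop :=
          lintegral_liminf_le fun k =>
            ((hφ k).continuous.mul hΔ.neg).measurable.ennreal_ofReal
      _ ≤ Filter.liminf (fun k => ENNReal.ofReal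
            (∫ y, W y * regDensity m (δ k) (‖y - x‖ ^ 2))) Filter.atTop := by
          refine Filter.liminf_le_liminf (Filter.Eventually.of_forall fun k => ?_)
          rw [← ofReal_integral_eq_lintegral_ofReal]
          · exact ENNReal.ofReal_le_ofReal (hle k)
          · exact ((hφ k).continuous.mul hΔ.neg).integrable_of_hasCompactSupport
              (hφs k).mul_right
          · exact Filter.Eventually.of_forall fun y =>
              mul_nonneg (hφ0 k y) (neg_nonneg.2 (hH y))
      _ = _ := (ENNReal.tendsto_ofReal ((tendsto_integral_mul_regDensity hm hn hW.continuous hM'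
            x).comp hδt)).liminf_eq
  have hint : Integrable fun y => (‖y - x‖ ^ 2) ^ (-m) * -laplacian W y := by
    refine ⟨hmeas.aestronglyMeasurable, ?_⟩
    rw [hasFiniteIntegral_iff_ofReal (Filter.Eventually.of_forall hnn)]
    exact hkey.trans_lt ENNReal.ofReal_lt_top
  refine ⟨hint, ?_⟩
  rw [integral_eq_lintegral_of_nonneg_ae (Filter.Eventually.of_forall hnn)
    hmeas.aestronglyMeasurable]
  exact ENNReal.toReal_le_of_le_ofReal (mul_nonneg (hW0 x) (kernelMass_pos hm hn).le) hkey

/-- The Newtonian kernel is a fundamental solution of `-Δ`, up to the factor `kernelMass`. -/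
lemma integral_kernel_mul_neg_laplacian {n : ℕ} {m : ℝ} (hm : 0 < m)
    (hn : (n : ℝ) = 2 * m + 2) {H : EuclideanSpace ℝ (Fin n) → ℝ} (hHc : Continuous H)
    (hH0 : ∀ y, 0 < H y) (x : EuclideanSpace ℝ (Fin n))
    (hH : Integrable fun y => (‖y - x‖ ^ 2) ^ (-m) * H y)
    {φ : EuclideanSpace ℝ (Fin n) → ℝ} (hφ : ContDiff ℝ 2 φ) (hφs : HasCompactSupport φ) :
    ∫ y, (‖y - x‖ ^ 2) ^ (-m) * -laplacian φ y = φ x * kernelMass n m := by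
  have hΔ := hφ.continuous_laplacian
  have hΔs := hasCompactSupport_laplacian hφs
  obtain ⟨K, hK⟩ := (hΔ.div hHc fun y => (hH0 y).ne').bounded_above_of_compact_support
    (show HasCompactSupport (fun y => laplacian φ y / H y) by
      simp only [div_eq_mul_inv]
      exact hΔs.mul_right)
  have hK' : ∀ y, |laplacian φ y| ≤ K * H y := fun y => by
    have := hK y
    simp only [Pi.div_apply] at this
    rwa [Real.norm_eq_abs, abs_div, abs_of_pos (hH0 y), div_le_iff₀ (hH0 y)] at this
  have : Nontrivial (EuclideanSpace ℝ (Fin n)) := by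
    refine Module.nontrivial_of_finrank_pos (R := ℝ) ?_
    rw [finrank_euclideanSpace_fin]
    have : (0 : ℝ) < n := by rw [hn]; positivity
    exact_mod_cast this
  have hlim : Filter.Tendsto
      (fun ε => ∫ y, regKernel m ε (‖y - x‖ ^ 2) * -laplacian φ y) (nhdsWithin 0 (Set.Ioi 0))
      (nhds (∫ y, (‖y - x‖ ^ 2) ^ (-m) * -laplacian φ y)) := by
    have hae : ∀ᵐ y : EuclideanSpace ℝ (Fin n), y ≠ x := by
      simp [ae_iff, measure_singleton]
    have hpos : ∀ y, y ≠ x → 0 < ‖y - x‖ ^ 2 := fun y hy => by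
      have := norm_pos_iff.2 (sub_ne_zero.2 hy)
      positivity
    refine tendsto_integral_filter_of_dominated_convergence
      (fun y => K * ((‖y - x‖ ^ 2) ^ (-m) * H y)) ?_ ?_ (hH.const_mul K) ?_
    · filter_upwards [self_mem_nhdsWithin] with ε hε
      exact ((contDiff_regKernel hε x).continuous.mul hΔ.neg).aestronglyMeasurable
    · filter_upwards [self_mem_nhdsWithin] with ε hε
      filter_upwards [hae] with y hy
      have h0 : 0 ≤ regKernel m ε (‖y - x‖ ^ 2) := by unfold regKernel; positivity
      have h1 : regKernel m ε (‖y - x‖ ^ 2) ≤ (‖y - x‖ ^ 2) ^ (-m) :=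
        Real.rpow_le_rpow_of_nonpos (hpos y hy) (by nlinarith [sq_nonneg ε]) (by linarith)
      rw [Real.norm_eq_abs, abs_mul, abs_neg, abs_of_nonneg h0, mul_left_comm]
      exact mul_le_mul h1 (hK' y) (abs_nonneg _) (by positivity)
    · filter_upwards [hae] with y hy
      exact (tendsto_regKernel (hpos y hy)).mul_const _
  obtain ⟨M, hM⟩ := hφ.continuous.bounded_above_of_compact_support hφs
  refine tendsto_nhds_unique hlim
    ((tendsto_integral_mul_regDensity hm hn hφ.continuous hM x).congr' ?_)
  filter_upwards [self_mem_nhdsWithin] with ε hε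
  simp_rw [mul_neg]
  rw [integral_neg, integral_mul_laplacian_comm (contDiff_infty.1 (contDiff_regKernel hε x) 2)
    hφ hφs, ← integral_neg]
  simp_rw [laplacian_regKernel hn hε]
  simp [mul_comm]

/-- The Newtonian potential of `g`, normalised to solve `-Δu = g`. -/
noncomputable def newtonianPotential {n : ℕ} (m : ℝ) (g : EuclideanSpace ℝ (Fin n) → ℝ)
    (x : EuclideanSpace ℝ (Fin n)) : ℝ :=
  (kernelMass n m)⁻¹ * ∫ y, (‖y - x‖ ^ 2) ^ (-m) * g y

lemma abs_newtonianPotential_le {n : ℕ} {m : ℝ} (hm : 0 < m) (hn : (n : ℝ) = 2 * m + 2)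
    {W : EuclideanSpace ℝ (Fin n) → ℝ} (hW : ContDiff ℝ 2 W)
    (hW0 : ∀ y, 0 ≤ W y) {M : ℝ} (hM : ∀ y, W y ≤ M) (hH : ∀ y, laplacian W y ≤ 0)
    {g : EuclideanSpace ℝ (Fin n) → ℝ} {K : ℝ} (hK : 0 ≤ K)
    (hg : ∀ y, |g y| ≤ K * -laplacian W y)
    (x : EuclideanSpace ℝ (Fin n)) : |newtonianPotential m g x| ≤ K * W x := by
  have hκ := kernelMass_pos hm hn
  obtain ⟨hi, hle⟩ := integrable_and_integral_potential_le hm hn hW hW0 hM hH x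
  have h1 : |∫ y, (‖y - x‖ ^ 2) ^ (-m) * g y| ≤ K * (W x * kernelMass n m) := by
    refine le_trans ?_ (mul_le_mul_of_nonneg_left hle hK)
    rw [← integral_const_mul, ← Real.norm_eq_abs]
    refine norm_integral_le_of_norm_le (hi.const_mul K) (Filter.Eventually.of_forall fun y => ?_)
    rw [Real.norm_eq_abs, abs_mul, abs_of_nonneg (by positivity), mul_left_comm]
    exact mul_le_mul_of_nonneg_left (hg y) (by positivity)
  rw [newtonianPotential, abs_mul, abs_of_pos (inv_pos.2 hκ), inv_mul_le_iff₀ hκ]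
  linarith

lemma continuous_newtonianPotential {n : ℕ} {m : ℝ}
    {g H : EuclideanSpace ℝ (Fin n) → ℝ} (hgc : Continuous g)
    (hH : Integrable fun y => (‖y‖ ^ 2) ^ (-m) * H y)
    (hg : ∀ R : ℝ, ∃ K, ∀ x y, ‖x‖ ≤ R → |g (x + y)| ≤ K * H y) :
    Continuous (newtonianPotential m g) := by
  have heq : newtonianPotential m g
      = fun x => (kernelMass n m)⁻¹ * ∫ y, (‖y‖ ^ 2) ^ (-m) * g (x + y) := by
    ext x
    rw [newtonianPotential, ← integral_add_left_eq_self _ x]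
    simp
  rw [heq]
  refine continuous_const.mul (continuous_iff_continuousAt.2 fun x => ?_)
  obtain ⟨K, hK⟩ := hg (‖x‖ + 1)
  refine continuousAt_of_dominated (bound := fun y => K * ((‖y‖ ^ 2) ^ (-m) * H y))
    ?_ ?_ (hH.const_mul K) ?_
  · refine Filter.Eventually.of_forall fun z => Measurable.aestronglyMeasurable ?_
    exact Measurable.mul (by fun_prop) (by fun_prop)
  · have : ∀ᶠ z in nhds x, ‖z‖ < ‖x‖ + 1 := continuous_norm.continuousAt.eventually_lt
      continuousAt_const (by linarith)
    filter_upwards [this] with z hz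
    refine Filter.Eventually.of_forall fun y => ?_
    rw [Real.norm_eq_abs, abs_mul, abs_of_nonneg (by positivity), mul_left_comm]
    exact mul_le_mul_of_nonneg_left (hK z y hz.le) (by positivity)
  · refine Filter.Eventually.of_forall fun y => ?_
    fun_prop

lemma integral_newtonianPotential_mul_neg_laplacian {n : ℕ} {m : ℝ} (hm : 0 < m)
    (hn : (n : ℝ) = 2 * m + 2) {W : EuclideanSpace ℝ (Fin n) → ℝ} (hW : ContDiff ℝ 2 W)
    (hW0 : ∀ y, 0 ≤ W y) {M : ℝ} (hM : ∀ y, W y ≤ M) (hH : ∀ y, laplacian W y < 0)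
    {g : EuclideanSpace ℝ (Fin n) → ℝ} (hgc : Continuous g) {K : ℝ} (hK : 0 ≤ K)
    (hg : ∀ y, |g y| ≤ K * -laplacian W y)
    {φ : EuclideanSpace ℝ (Fin n) → ℝ} (hφ : ContDiff ℝ 2 φ) (hφs : HasCompactSupport φ) :
    ∫ x, newtonianPotential m g x * -laplacian φ x = ∫ x, g x * φ x := by
  have hκ := kernelMass_pos hm hn
  have hΔ := hφ.continuous_laplacian
  have hΔs := hasCompactSupport_laplacian hφs
  have hpot := integrable_and_integral_potential_le hm hn hW hW0 hM fun y => (hH y).le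
  have hmeas : Measurable (Function.uncurry fun x y =>
      (‖y - x‖ ^ 2) ^ (-m) * g y * -laplacian φ x) :=
    Measurable.mul (Measurable.mul (by fun_prop) (hgc.measurable.comp measurable_snd))
      (hΔ.measurable.comp measurable_fst).neg
  have hgi : ∀ x, Integrable fun y => (‖y - x‖ ^ 2) ^ (-m) * g y := fun x => by
    refine ((hpot x).1.const_mul K).mono'
      (Measurable.aestronglyMeasurable (Measurable.mul (by fun_prop) hgc.measurable))
      (Filter.Eventually.of_forall fun y => ?_)
    rw [Real.norm_eq_abs, abs_mul, abs_of_nonneg (by positivity), mul_left_comm]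
    exact mul_le_mul_of_nonneg_left (hg y) (by positivity)
  have hprod : Integrable (Function.uncurry fun x y =>
      (‖y - x‖ ^ 2) ^ (-m) * g y * -laplacian φ x) (volume.prod volume) := by
    rw [integrable_prod_iff hmeas.aestronglyMeasurable]
    refine ⟨Filter.Eventually.of_forall fun x => (hgi x).mul_const (-laplacian φ x), ?_⟩
    have hdom : Integrable fun x => K * (W x * kernelMass n m) * |laplacian φ x| :=
      ((continuous_const.mul (hW.continuous.mul continuous_const)).mul
        hΔ.abs).integrable_of_hasCompactSupport
        (HasCompactSupport.mul_left (hΔs.comp_left (g := abs) abs_zero))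
    refine hdom.mono' hmeas.aestronglyMeasurable.norm.integral_prod_right'
      (Filter.Eventually.of_forall fun x => ?_)
    have h1 : ∫ y, ‖(‖y - x‖ ^ 2) ^ (-m) * g y * -laplacian φ x‖
        = (∫ y, ‖(‖y - x‖ ^ 2) ^ (-m) * g y‖) * |laplacian φ x| := by
      rw [← integral_mul_const]
      simp
    have h2 : ∫ y, ‖(‖y - x‖ ^ 2) ^ (-m) * g y‖ ≤ K * (W x * kernelMass n m) := by
      refine le_trans ?_ (mul_le_mul_of_nonneg_left (hpot x).2 hK)
      rw [← integral_const_mul]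
      refine integral_mono (hgi x).norm ((hpot x).1.const_mul K) fun y => ?_
      simp only
      rw [Real.norm_eq_abs, abs_mul, abs_of_nonneg (by positivity), mul_left_comm]
      exact mul_le_mul_of_nonneg_left (hg y) (by positivity)
    rw [Real.norm_of_nonneg (integral_nonneg fun y => norm_nonneg _)]
    exact h1.trans_le (mul_le_mul_of_nonneg_right h2 (abs_nonneg _))
  have hfund : ∀ y, ∫ x, (‖y - x‖ ^ 2) ^ (-m) * g y * -laplacian φ x
      = kernelMass n m * (g y * φ y) := by
    intro y
    have := integral_kernel_mul_neg_laplacian hm hn hW.continuous_laplacian.neg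
      (fun y => neg_pos.2 (hH y)) y (hpot y).1 hφ hφs
    rw [mul_left_comm, mul_comm (kernelMass n m), ← this, ← integral_const_mul]
    congr 1 with x
    rw [norm_sub_rev]
    ring
  calc ∫ x, newtonianPotential m g x * -laplacian φ x
      = (kernelMass n m)⁻¹ * ∫ x, ∫ y, (‖y - x‖ ^ 2) ^ (-m) * g y * -laplacian φ x := by
        rw [← integral_const_mul]
        congr 1 with x
        rw [integral_mul_const, newtonianPotential, mul_assoc]
    _ = (kernelMass n m)⁻¹ * ∫ y, ∫ x, (‖y - x‖ ^ 2) ^ (-m) * g y * -laplacian φ x := by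
        rw [integral_integral_swap hprod]
    _ = ∫ x, g x * φ x := by
        simp_rw [hfund]
        rw [integral_const_mul, inv_mul_cancel_left₀ hκ.ne']

lemma contDiff_log_rpow {n : ℕ} {A : ℝ} (hA : 2 ≤ A) (α : ℝ) :
    ContDiff ℝ 2 fun y : EuclideanSpace ℝ (Fin n) => Real.log (A + ‖y‖ ^ 2) ^ (-α) := by
  refine ContDiff.rpow_const_of_ne (ContDiff.log (contDiff_const.add (contDiff_norm_sq ℝ))
    fun y => ?_) fun y => (Real.log_pos ?_).ne'
  · positivity
  · linarith [sq_nonneg ‖y‖]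

/-- For `A` large, `log (A + ‖y‖²) ^ (-α)` is a strict supersolution in dimension at least 3. -/
lemma log_rpow_le_neg_laplacian {n : ℕ} (hn : 3 ≤ n) {α A : ℝ} (hα : 0 < α) (hA : 2 ≤ A)
    (hAα : 4 * (α + 1) ≤ Real.log A) (y : EuclideanSpace ℝ (Fin n)) :
    α * ((A + ‖y‖ ^ 2)⁻¹ * Real.log (A + ‖y‖ ^ 2) ^ (-α - 1)) ≤
      -laplacian (fun y => Real.log (A + ‖y‖ ^ 2) ^ (-α)) y := by
  have hpos : ∀ s : ℝ, 0 ≤ s → 0 < A + s := fun s hs => by linarith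
  have hlog : ∀ s : ℝ, 0 ≤ s → 0 < Real.log (A + s) := fun s hs =>
    Real.log_pos (by linarith)
  have hdlog : ∀ s : ℝ, 0 ≤ s → HasDerivAt (fun s => Real.log (A + s)) (A + s)⁻¹ s := by
    intro s hs
    simpa using ((hasDerivAt_id s).const_add A).log (hpos s hs).ne'
  have hdinv : ∀ s : ℝ, 0 ≤ s → HasDerivAt (fun s => (A + s)⁻¹) (-(A + s)⁻¹ ^ 2) s := by
    intro s hs
    refine (((hasDerivAt_id s).const_add A).inv (hpos s hs).ne').congr_deriv ?_
    simp [neg_div]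
  have hdpow : ∀ p s : ℝ, 0 ≤ s → HasDerivAt (fun s => Real.log (A + s) ^ p)
      ((A + s)⁻¹ * p * Real.log (A + s) ^ (p - 1)) s := fun p s hs =>
    (hdlog s hs).rpow_const (Or.inl (hlog s hs).ne')
  have h := laplacian_comp_norm_sub_sq (n := n) (F := fun s => Real.log (A + s) ^ (-α))
    (F' := fun s => (A + s)⁻¹ * (-α) * Real.log (A + s) ^ (-α - 1))
    (fun s hs => hdpow (-α) s hs)
    (fun s hs => ((hdinv s hs).mul_const (-α)).mul (hdpow (-α - 1) s hs)) 0 y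
  simp only [sub_zero] at h
  rw [h]
  set s := ‖y‖ ^ 2 with hs
  have hs0 : 0 ≤ s := sq_nonneg _
  have hL := hlog s hs0
  have hL4 : 4 * (α + 1) ≤ Real.log (A + s) :=
    hAα.trans (Real.log_le_log (by linarith) (by linarith))
  have e : Real.log (A + s) ^ (-α - 1) = Real.log (A + s) ^ (-α - 1 - 1) * Real.log (A + s) := by
    rw [← Real.rpow_add_one hL.ne']; ring_nf
  rw [e]
  have hP : 0 < Real.log (A + s) ^ (-α - 1 - 1) := Real.rpow_pos_of_pos hL _
  have hi : 0 < (A + s)⁻¹ := inv_pos.2 (hpos s hs0)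
  have hsi : s * (A + s)⁻¹ ≤ 1 := by
    rw [← div_eq_mul_inv, div_le_one (hpos s hs0)]; linarith
  have hn' : (3 : ℝ) ≤ n := by exact_mod_cast hn
  generalize Real.log (A + s) ^ (-α - 1 - 1) = P at *
  generalize Real.log (A + s) = L at *
  generalize (A + s)⁻¹ = I at *
  have hmain : 0 ≤ (2 * n - 1) * L - 4 * (s * I) * (L + (α + 1)) := by
    nlinarith [mul_le_mul_of_nonneg_right hsi (by linarith : 0 ≤ L + (α + 1)),
      mul_le_mul_of_nonneg_right hn' hL.le]
  have := mul_nonneg (mul_nonneg (mul_nonneg hα.le hi.le) hP.le) hmain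
  linarith

lemma exists_decay_comparison {α A : ℝ} (hα : 0 < α) (hA : 2 ≤ A) {E : Type*}
    [NormedAddCommGroup E] (R : ℝ) : ∃ K, 0 ≤ K ∧ ∀ x y : E, ‖x‖ ≤ R →
      Real.log (2 + ‖x + y‖ ^ 2) ^ (-α - 1) / (1 + ‖x + y‖ ^ 2)
        ≤ K * ((A + ‖y‖ ^ 2)⁻¹ * Real.log (A + ‖y‖ ^ 2) ^ (-α - 1)) := by
  set M := A + 2 * R ^ 2 + 2 with hMdef
  have hM : 2 ≤ M := by nlinarith [sq_nonneg R]
  have hl2 : 0 < Real.log 2 := Real.log_pos one_lt_two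
  set B := Real.log M / Real.log 2 + 1 with hB
  have hB0 : 0 < B := by
    have := Real.log_nonneg (by linarith : (1 : ℝ) ≤ M)
    positivity
  refine ⟨M * B ^ (α + 1), by positivity, fun x y hx => ?_⟩
  set t := ‖x + y‖ ^ 2 with ht
  have ht0 : 0 ≤ t := sq_nonneg _
  have hy0 : 0 ≤ ‖y‖ ^ 2 := sq_nonneg _
  have h1 : A + ‖y‖ ^ 2 ≤ M * (1 + t) := by
    have hy : ‖y‖ ≤ R + ‖x + y‖ := by
      have := norm_sub_le (x + y) x
      rw [add_sub_cancel_left] at this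
      linarith
    have : ‖y‖ ^ 2 ≤ 2 * R ^ 2 + 2 * t := by
      nlinarith [sq_nonneg (R - ‖x + y‖), norm_nonneg y]
    nlinarith [mul_nonneg (sq_nonneg R) ht0]
  have hlt : Real.log 2 ≤ Real.log (2 + t) := Real.log_le_log two_pos (by linarith)
  have hlt0 : 0 < Real.log (2 + t) := hl2.trans_le hlt
  have hly : 0 < Real.log (A + ‖y‖ ^ 2) := Real.log_pos (by linarith)
  have h2 : Real.log (A + ‖y‖ ^ 2) ≤ B * Real.log (2 + t) := by
    have h3 : Real.log (A + ‖y‖ ^ 2) ≤ Real.log M + Real.log (2 + t) := by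
      rw [← Real.log_mul (by positivity) (by positivity)]
      exact Real.log_le_log (by positivity) (h1.trans (by gcongr; norm_num))
    have h4 : Real.log M ≤ Real.log M / Real.log 2 * Real.log (2 + t) := by
      rw [div_mul_eq_mul_div, le_div_iff₀ hl2]
      exact mul_le_mul_of_nonneg_left hlt (Real.log_nonneg (by linarith))
    rw [hB]
    linarith
  have h5 : Real.log (2 + t) ^ (-α - 1) ≤ B ^ (α + 1) * Real.log (A + ‖y‖ ^ 2) ^ (-α - 1) := by
    have h6 := Real.rpow_le_rpow_of_nonpos hly h2 (by linarith : -α - 1 ≤ 0)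
    rw [Real.mul_rpow hB0.le hlt0.le] at h6
    have h7 := mul_le_mul_of_nonneg_left h6 (Real.rpow_nonneg hB0.le (α + 1))
    rwa [← mul_assoc, ← Real.rpow_add hB0, show α + 1 + (-α - 1) = 0 by ring, Real.rpow_zero,
      one_mul] at h7
  have h8 : (1 + t)⁻¹ ≤ M * (A + ‖y‖ ^ 2)⁻¹ := by
    rw [← div_eq_mul_inv, le_div_iff₀ (by positivity), inv_mul_le_iff₀ (by positivity)]
    linarith
  rw [div_eq_mul_inv]
  calc _ ≤ (B ^ (α + 1) * Real.log (A + ‖y‖ ^ 2) ^ (-α - 1)) * (M * (A + ‖y‖ ^ 2)⁻¹) :=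
        mul_le_mul h5 h8 (by positivity) (by positivity)
    _ = _ := by ring

lemma log_rpow_anti {α A s : ℝ} (hα : 0 < α) (hA : 2 ≤ A) (hs : 0 ≤ s) :
    Real.log (A + s) ^ (-α) ≤ Real.log (2 + s) ^ (-α) :=
  Real.rpow_le_rpow_of_nonpos (Real.log_pos (by linarith))
    (Real.log_le_log (by linarith) (by linarith)) (by linarith)

lemma exists_log_rpow_le {α η : ℝ} (hα : 0 < α) (hη : 0 < η) :
    ∃ ρ : ℝ, ∀ r, ρ ≤ r → Real.log (2 + r ^ 2) ^ (-α) ≤ η := by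
  have h : Filter.Tendsto (fun r : ℝ => Real.log (2 + r ^ 2) ^ (-α)) Filter.atTop (nhds 0) :=
    (tendsto_rpow_neg_atTop hα).comp (Real.tendsto_log_atTop.comp
      (Filter.tendsto_atTop_add_const_left _ _ (Filter.tendsto_pow_atTop two_ne_zero)))
  exact Filter.eventually_atTop.1 (h.eventually_le_const hη)

/-- Let `n > 2`, `α > 0`. For every continuous `f` with
`|f(x)| ≤ C(log(2+|x|²))^(−α−1)`, there is exactly one bounded solution `u` of
`−(1+|x|²)Δu = f` (weak formulation: `−Δu = f/(1+|x|²)`) satisfying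
`|u(x)| ≤ C'(log(2+|x|²))^(−α)`. -/
theorem exists_unique_log_decaying_solution (n : ℕ) (hn : 2 < n) (α : ℝ) (hα : 0 < α)
    (C : ℝ) (f : EuclideanSpace ℝ (Fin n) → ℝ) (hf : Continuous f)
    (hfb : ∀ x, |f x| ≤ C * (Real.log (2 + ‖x‖ ^ 2)) ^ (-α - 1)) :
    ∃! u : EuclideanSpace ℝ (Fin n) → ℝ,
      Continuous u ∧
      (∃ C' > 0, ∀ x, |u x| ≤ C' * (Real.log (2 + ‖x‖ ^ 2)) ^ (-α)) ∧
      (∀ φ : EuclideanSpace ℝ (Fin n) → ℝ, ContDiff ℝ (⊤ : ℕ∞) φ → HasCompactSupport φ →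
        ∫ x, u x * (-laplacian φ x) = ∫ x, (f x / (1 + ‖x‖ ^ 2)) * φ x) := by

  have hm : (0 : ℝ) < (n : ℝ) / 2 - 1 := by
    have : (2 : ℝ) < n := by exact_mod_cast hn
    linarith
  generalize hmdef : (n : ℝ) / 2 - 1 = m at hm
  have hnm : (n : ℝ) = 2 * m + 2 := by linarith
  obtain ⟨A, hA, hAα⟩ : ∃ A : ℝ, 2 ≤ A ∧ 4 * (α + 1) ≤ Real.log A :=
    ⟨Real.exp (4 * (α + 1)), by linarith [Real.add_one_le_exp (4 * (α + 1))],
      (Real.log_exp _).ge⟩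
  set W : EuclideanSpace ℝ (Fin n) → ℝ := fun y => Real.log (A + ‖y‖ ^ 2) ^ (-α) with hWdef
  have hW : ContDiff ℝ 2 W := contDiff_log_rpow hA α
  have hlogpos : ∀ y : EuclideanSpace ℝ (Fin n), 0 < Real.log (A + ‖y‖ ^ 2) := fun y =>
    Real.log_pos (by linarith [sq_nonneg ‖y‖])
  have hlog2pos : ∀ y : EuclideanSpace ℝ (Fin n), 0 < Real.log (2 + ‖y‖ ^ 2) := fun y =>
    Real.log_pos (by linarith [sq_nonneg ‖y‖])
  have hlog2le : ∀ y : EuclideanSpace ℝ (Fin n),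
      Real.log (2 + ‖y‖ ^ 2) ^ (-α) ≤ Real.log 2 ^ (-α) := fun y =>
    Real.rpow_le_rpow_of_nonpos (Real.log_pos one_lt_two)
      (Real.log_le_log two_pos (by linarith [sq_nonneg ‖y‖])) (by linarith)
  have hW0 : ∀ y, 0 ≤ W y := fun y => Real.rpow_nonneg (hlogpos y).le _
  have hW2 : ∀ y, W y ≤ Real.log (2 + ‖y‖ ^ 2) ^ (-α) := fun y =>
    log_rpow_anti hα hA (sq_nonneg _)
  have hWM : ∀ y, W y ≤ Real.log 2 ^ (-α) := fun y => (hW2 y).trans (hlog2le y)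
  have hWΔ := log_rpow_le_neg_laplacian (n := n) hn hα hA hAα
  have hWneg : ∀ y, laplacian W y < 0 := fun y => by
    have h1 : 0 < α * ((A + ‖y‖ ^ 2)⁻¹ * Real.log (A + ‖y‖ ^ 2) ^ (-α - 1)) :=
      mul_pos hα (mul_pos (by positivity) (Real.rpow_pos_of_pos (hlogpos y) _))
    linarith [hWΔ y]
  set g : EuclideanSpace ℝ (Fin n) → ℝ := fun y => f y / (1 + ‖y‖ ^ 2) with hgdef
  have hgc : Continuous g := hf.div (by fun_prop) fun y => by positivity
  have hgK : ∀ R : ℝ, ∃ K, 0 ≤ K ∧ ∀ x y, ‖x‖ ≤ R → |g (x + y)| ≤ K * -laplacian W y := by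
    intro R
    obtain ⟨K, hK, hKb⟩ := exists_decay_comparison (E := EuclideanSpace ℝ (Fin n)) hα hA R
    refine ⟨|C| * K / α, by positivity, fun x y hx => ?_⟩
    have h1 : |g (x + y)| ≤
        |C| * (Real.log (2 + ‖x + y‖ ^ 2) ^ (-α - 1) / (1 + ‖x + y‖ ^ 2)) := by
      rw [hgdef, abs_div, abs_of_pos (by positivity : 0 < 1 + ‖x + y‖ ^ 2), ← mul_div_assoc]
      gcongr
      exact (hfb _).trans (mul_le_mul_of_nonneg_right (le_abs_self C)
        (Real.rpow_nonneg (hlog2pos _).le _))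
    calc |g (x + y)| ≤ |C| * (K * ((A + ‖y‖ ^ 2)⁻¹ * Real.log (A + ‖y‖ ^ 2) ^ (-α - 1))) :=
          h1.trans (mul_le_mul_of_nonneg_left (hKb x y hx) (abs_nonneg C))
      _ = |C| * K / α * (α * ((A + ‖y‖ ^ 2)⁻¹ * Real.log (A + ‖y‖ ^ 2) ^ (-α - 1))) := by
          field_simp
      _ ≤ _ := mul_le_mul_of_nonneg_left (hWΔ y) (by positivity)
  obtain ⟨K, hK, hgb⟩ : ∃ K, 0 ≤ K ∧ ∀ y, |g y| ≤ K * -laplacian W y := by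
    obtain ⟨K, hK, hKb⟩ := hgK 0
    exact ⟨K, hK, fun y => by simpa using hKb 0 y (by simp)⟩
  have hu := abs_newtonianPotential_le hm hnm hW hW0 hWM (fun y => (hWneg y).le) hK hgb
  have hsol : Continuous (newtonianPotential m g) ∧
      (∃ C' > 0, ∀ x, |newtonianPotential m g x| ≤ C' * Real.log (2 + ‖x‖ ^ 2) ^ (-α)) ∧
      (∀ φ : EuclideanSpace ℝ (Fin n) → ℝ, ContDiff ℝ (⊤ : ℕ∞) φ → HasCompactSupport φ →
        ∫ x, newtonianPotential m g x * (-laplacian φ x) = ∫ x, g x * φ x) := by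
    refine ⟨?_, ⟨K + 1, by linarith, fun x => (hu x).trans ?_⟩, fun φ hφ hφs => ?_⟩
    · have hi := (integrable_and_integral_potential_le hm hnm hW hW0 hWM
        (fun y => (hWneg y).le) 0).1
      simp only [sub_zero] at hi
      refine continuous_newtonianPotential hgc hi fun R => ?_
      obtain ⟨K, -, hKb⟩ := hgK R
      exact ⟨K, hKb⟩
    · exact mul_le_mul (by linarith) (hW2 x) (hW0 x) (by linarith)
    · exact integral_newtonianPotential_mul_neg_laplacian hm hnm hW hW0 hWM hWneg hgc hK hgb
        (contDiff_infty.1 hφ 2) hφs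
  refine ⟨newtonianPotential m g, hsol, ?_⟩
  rintro v ⟨hvc, ⟨C₁, hC₁, hvb⟩, hv⟩
  obtain ⟨huc, ⟨C₂, hC₂, hub⟩, hu'⟩ := hsol
  ext x
  have hdiff : ∀ y, |v y - newtonianPotential m g y|
      ≤ (C₁ + C₂) * Real.log (2 + ‖y‖ ^ 2) ^ (-α) := fun y => by
    linarith [abs_sub (v y) (newtonianPotential m g y), hvb y, hub y]
  refine sub_eq_zero.1 (eq_zero_of_weakly_harmonic
    (w := fun y => v y - newtonianPotential m g y) hm hnm (hvc.sub huc)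
    (fun y => (hdiff y).trans (mul_le_mul_of_nonneg_left (hlog2le y) (by positivity))) ?_ ?_ x)
  · intro η hη
    obtain ⟨ρ, hρ⟩ := exists_log_rpow_le hα (div_pos hη (add_pos hC₁ hC₂))
    refine ⟨ρ, fun y hy => (hdiff y).trans ?_⟩
    have := mul_le_mul_of_nonneg_left (hρ _ hy) (add_pos hC₁ hC₂).le
    rwa [mul_div_cancel₀ _ (add_pos hC₁ hC₂).ne'] at this
  · intro φ hφ hφs
    have hΔ := (contDiff_infty.1 hφ 2).continuous_laplacian
    have hi : ∀ w : EuclideanSpace ℝ (Fin n) → ℝ, Continuous w →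
        Integrable fun y => w y * -laplacian φ y := fun w hw =>
      (hw.mul hΔ.neg).integrable_of_hasCompactSupport
        (hasCompactSupport_laplacian hφs).neg.mul_left
    have h1 := (hv φ hφ hφs).trans (hu' φ hφ hφs).symm
    rw [← sub_eq_zero, ← integral_sub (hi v hvc) (hi _ huc)] at h1
    rw [← neg_eq_zero, ← integral_neg, ← h1]
    congr 1 with y
    ring
end
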